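/- arXiv:2005.01886 — 9 statements merged into one kernel-verified Lean document; each statement's English description precedes it below -/
import Mathlib

section
/- Let Ω be a metric space whose density is greater than or equal to some atomlessly measurable cardinal. Then the k-nearest neighbour learning rule in Ω is not universally consistent. -/
open MeasureTheory Filter Set Metric Cardinal
open scoped ENNReal

noncomputable section

universe u

/-- A cardinal `τ` is *real-valued measurable* if a set of cardinality `τ` carries a
probability measure defined on *all* subsets, vanishing on singletons, whose ideal of
null sets is closed under unions of fewer than `τ` members. -/
def IsRealValuedMeasurableCardinal (τ : Cardinal.{u}) : Prop :=
  ∃ μ : @Measure τ.out ⊤,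
    μ Set.univ = 1 ∧
    (∀ x : τ.out, μ {x} = 0) ∧
    ∀ 𝒩 : Set (Set τ.out), #𝒩 < τ → (∀ A ∈ 𝒩, μ A = 0) → μ (⋃₀ 𝒩) = 0

/-- The density of a topological space: the least cardinality of a dense subset. -/
def densityCard (X : Type u) [TopologicalSpace X] : Cardinal.{u} :=
  sInf {c : Cardinal.{u} | ∃ s : Set X, Dense s ∧ #s = c}

/-- The label assigned to the point `x` by the `k`-nearest-neighbour rule on the labelled
sample `σ`, distance ties being broken according to the ordering `π` of the sample, and
voting ties broken in favour of the label `1` (`true`).  An index `i` is among the `k`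
nearest neighbours of `x` iff fewer than `k` indices precede it in the lexicographic
order (distance to `x`, position under `π`). -/
def kNNLabel {Ω : Type u} [MetricSpace Ω] (n k : ℕ) (σ : Fin n → Ω × Bool)
    (π : Equiv.Perm (Fin n)) (x : Ω) : Bool :=
  let nearer : Fin n → Fin n → Prop := fun j i =>
    dist x (σ j).1 < dist x (σ i).1 ∨ (dist x (σ j).1 = dist x (σ i).1 ∧ π j < π i)
  let S : Set (Fin n) := {i | Set.ncard {j | nearer j i} < k}
  decide (k ≤ 2 * Set.ncard {i ∈ S | (σ i).2 = true})

/-- The expected misclassification error of the `k`-nearest neighbour rule at sample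
size `n`, for i.i.d. data with law `μt`, the tie-breaking order of the sample being
chosen uniformly at random among all `n!` orderings. -/
def kNNError {Ω : Type u} [MetricSpace Ω] [MeasurableSpace Ω]
    (μt : Measure (Ω × Bool)) (n k : ℕ) : ℝ≥0∞ :=
  (∑ π : Equiv.Perm (Fin n),
      (Measure.pi fun _ : Fin n => μt).prod μt
        {q : (Fin n → Ω × Bool) × (Ω × Bool) | kNNLabel n k q.1 π q.2.1 ≠ q.2.2}) /
    (Nat.factorial n : ℝ≥0∞)

/-- The Bayes (optimal) error of the learning problem given by a probability measure on
`Ω × {0,1}`: the infimum of the misclassification errors of all measurable classifiers. -/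
def bayesError {Ω : Type u} [MeasurableSpace Ω] (μt : Measure (Ω × Bool)) : ℝ≥0∞ :=
  ⨅ (T : Ω → Bool) (_ : Measurable T), μt {p : Ω × Bool | T p.1 ≠ p.2}

/-- The `k`-nearest neighbour classifier is universally consistent in the metric space `Ω`
(with its Borel sigma-algebra): for every choice of `k = kₙ` with `kₙ → ∞` and `kₙ/n → 0`
and every probability measure `μ̃` on `Ω × {0,1}`, the expected misclassification error at
sample size `n` converges to the Bayes error of `μ̃`. -/
def kNNUniversallyConsistent (Ω : Type u) [MetricSpace Ω] : Prop :=
  letI : MeasurableSpace Ω := borel Ω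
  ∀ k : ℕ → ℕ, Tendsto k atTop atTop →
    Tendsto (fun n : ℕ => (k n : ℝ) / n) atTop (nhds 0) →
    ∀ μt : Measure (Ω × Bool), IsProbabilityMeasure μt →
      Tendsto (fun n : ℕ => kNNError μt n (k n)) atTop (nhds (bayesError μt))

/-- A cardinal `τ` is *atomlessly measurable* if a set of cardinality `τ` carries an
atomless probability measure defined on all subsets, vanishing on singletons, whose
ideal of null sets is closed under unions of fewer than `τ` members.  (Atomless: every
set of positive measure has a subset of strictly smaller positive measure.) -/
def IsAtomlesslyMeasurableCardinal (τ : Cardinal.{u}) : Prop :=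
  ∃ μ : @Measure τ.out ⊤,
    μ Set.univ = 1 ∧
    (∀ x : τ.out, μ {x} = 0) ∧
    (∀ A : Set τ.out, 0 < μ A → ∃ B ⊆ A, 0 < μ B ∧ μ B < μ A) ∧
    ∀ 𝒩 : Set (Set τ.out), #𝒩 < τ → (∀ A ∈ 𝒩, μ A = 0) → μ (⋃₀ 𝒩) = 0


namespace KNNAux

theorem exists_small_algebra {Y : Type u} (𝒰 : Set (Set Y)) (c : Cardinal.{u}) (hc : ℵ₀ < c)
    (h : #𝒰 < c) : #(generateSetAlgebra 𝒰) < c := by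
  classical
  let ind : Set Y → (Y → ZMod 2) := fun s => s.indicator 1
  have hinj : Function.Injective ind := by
    intro s t hst
    ext y
    have := congrFun hst y
    by_cases h1 : y ∈ s <;> by_cases h2 : y ∈ t <;> simp_all [ind]
  let R := Algebra.adjoin (ZMod 2) (ind '' 𝒰)
  have hsub : ∀ s ∈ generateSetAlgebra 𝒰, ind s ∈ R := by
    intro s hs
    induction hs with
    | base s hs => exact Algebra.subset_adjoin ⟨s, hs, rfl⟩
    | empty =>
      have : ind ∅ = 0 := by ext y; simp [ind]
      rw [this]; exact zero_mem _
    | compl s hs ih =>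
      have : ind sᶜ = 1 - ind s := by
        ext y; by_cases h1 : y ∈ s <;> simp [ind, h1]
      rw [this]; exact sub_mem (one_mem _) ih
    | union s t hs ht ih1 ih2 =>
      have : ind (s ∪ t) = ind s + ind t - ind s * ind t := by
        ext y; by_cases h1 : y ∈ s <;> by_cases h2 : y ∈ t <;> simp [ind, h1, h2]
      rw [this]; exact sub_mem (add_mem ih1 ih2) (mul_mem ih1 ih2)
  have h1 : #(generateSetAlgebra 𝒰) ≤ #R :=
    Cardinal.mk_le_of_injective (f := fun s => (⟨ind s.1, hsub _ s.2⟩ : R))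
      (fun s t hst => Subtype.ext (hinj (congrArg Subtype.val hst)))
  have h2 := Algebra.lift_cardinalMk_adjoin_le (ZMod 2) (ind '' 𝒰)
  simp only [Cardinal.lift_uzero] at h2
  refine h1.trans_lt (h2.trans_lt ?_)
  refine max_lt (max_lt ?_ (Cardinal.mk_image_le.trans_lt h)) hc
  refine lt_trans ?_ hc
  rw [Cardinal.lift_lt_aleph0]
  exact Cardinal.mk_lt_aleph0

theorem outer_approx {Y : Type u} [mY : MeasurableSpace Y] (ν : Measure Y) [IsFiniteMeasure ν]
    (𝒱 : Set (Set Y)) (hV : IsSetAlgebra 𝒱) (hgen : mY = MeasurableSpace.generateFrom 𝒱)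
    (M : Set Y) (hM : MeasurableSet M) (ε : ℝ≥0∞) (hε : ε ≠ 0) :
    ∃ U : ℕ → 𝒱, M ⊆ ⋃ i, (U i : Set Y) ∧ ν (⋃ i, (U i : Set Y)) ≤ ν M + ε := by
  classical
  have hVm : ∀ s ∈ 𝒱, MeasurableSet s := fun s hs => by
    rw [hgen]; exact MeasurableSpace.measurableSet_generateFrom hs
  let m : Set Y → ℝ≥0∞ := fun s => if s ∈ 𝒱 then ν s else ∞
  have m0 : m ∅ = 0 := by simp [m, hV.empty_mem]
  let θ := OuterMeasure.ofFunction m m0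
  have hcar : mY ≤ θ.caratheodory := by
    rw [hgen]
    refine MeasurableSpace.generateFrom_le fun s hs => ?_
    refine OuterMeasure.ofFunction_caratheodory fun t => ?_
    by_cases ht : t ∈ 𝒱
    · simp only [m, ht, hV.inter_mem ht hs, hV.sdiff_mem ht hs, if_true]
      exact (measure_inter_add_sdiff t (hVm s hs)).le
    · simp [m, ht]
  have hle : ν.toOuterMeasure ≤ θ := by
    rw [OuterMeasure.le_ofFunction]
    intro s
    by_cases hs : s ∈ 𝒱 <;> simp [m, hs]
  have heq : ∀ s ∈ 𝒱, ν s = θ.toMeasure hcar s := by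
    intro s hs
    rw [toMeasure_apply _ _ (hVm s hs)]
    refine le_antisymm (hle s) ((OuterMeasure.ofFunction_le s).trans ?_)
    simp [m, hs]
  have hν : ν = θ.toMeasure hcar :=
    ext_of_generate_finite 𝒱 hgen (fun s hs t ht _ => hV.inter_mem hs ht) heq
      (heq _ hV.univ_mem)
  have h1 : θ M < ν M + ε := by
    have : ν M = θ M := by
      conv_lhs => rw [hν]
      rw [toMeasure_apply _ _ hM]
    rw [← this]
    exact ENNReal.lt_add_right (measure_ne_top _ _) hε
  simp only [θ, OuterMeasure.ofFunction_apply, iInf_lt_iff] at h1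
  obtain ⟨t, htM, ht⟩ := h1
  have htV : ∀ i, t i ∈ 𝒱 := by
    intro i
    by_contra hi
    have : m (t i) = ∞ := by simp [m, hi]
    have h2 : (∞ : ℝ≥0∞) ≤ ∑' n, m (t n) := this ▸ ENNReal.le_tsum i
    exact absurd (h2.trans_lt ht) (by simp)
  refine ⟨fun i => ⟨t i, htV i⟩, htM, ?_⟩
  refine (measure_iUnion_le _).trans (le_trans (le_of_eq ?_) ht.le)
  congr 1; ext i; simp [m, htV i]

theorem gdelta_approx {Y : Type u} [mY : MeasurableSpace Y] (ν : Measure Y) [IsFiniteMeasure ν]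
    (𝒱 : Set (Set Y)) (hV : IsSetAlgebra 𝒱) (hgen : mY = MeasurableSpace.generateFrom 𝒱)
    (M : Set Y) (hM : MeasurableSet M) :
    ∃ U : ℕ → ℕ → 𝒱, (⋂ j, ⋃ i, (U j i : Set Y)) =ᵐ[ν] M := by
  have hVm : ∀ s ∈ 𝒱, MeasurableSet s := fun s hs => by
    rw [hgen]; exact MeasurableSpace.measurableSet_generateFrom hs
  choose U hU1 hU2 using fun j : ℕ => outer_approx ν 𝒱 hV hgen M hM ((j : ℝ≥0∞) + 1)⁻¹ (by simp)
  refine ⟨U, ?_⟩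
  have hsub : M ⊆ ⋂ j, ⋃ i, (U j i : Set Y) := subset_iInter hU1
  refine (ae_eq_of_subset_of_measure_ge hsub ?_ hM.nullMeasurableSet (measure_ne_top _ _)).symm
  refine ENNReal.le_of_forall_pos_le_add fun ε hε _ => ?_
  obtain ⟨n, hn⟩ := ENNReal.exists_inv_nat_lt (a := ε) (by simpa using hε.ne')
  refine (measure_mono (iInter_subset _ n)).trans ((hU2 n).trans ?_)
  gcongr
  refine le_trans ?_ hn.le
  exact ENNReal.inv_le_inv.2 (by simp)

/-- A total, additive diffuse measure on a set well-ordered in its initial type. -/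
structure RVM (K : Type u) [MeasurableSpace K] [LinearOrder K] (μ : Measure K) : Prop where
  meas : ∀ s : Set K, MeasurableSet s
  add : ∀ (ι : Type u) (N : ι → Set K), #ι < #K → (∀ i, μ (N i) = 0) → μ (⋃ i, N i) = 0
  single : ∀ x, μ {x} = 0
  seg : ∀ x : K, #(Iio x) < #K

section

variable {K : Type u} [MeasurableSpace K] [LinearOrder K] {μ : Measure K}

theorem RVM.small (h : RVM K μ) (s : Set K) (hs : #s < #K) : μ s = 0 := by
  have := h.add s (fun x => {x.1}) hs (fun x => h.single _)
  simpa using this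

theorem RVM.Iio (h : RVM K μ) (x : K) : μ (Iio x) = 0 := h.small _ (h.seg x)

theorem RVM.Iic (h : RVM K μ) (x : K) : μ (Iic x) = 0 := by
  rw [← Iio_union_right]
  exact measure_union_null (h.Iio x) (h.single x)

theorem RVM.aleph0_lt (h : RVM K μ) [IsProbabilityMeasure μ] : ℵ₀ < #K := by
  by_contra hc
  have : Countable K := Cardinal.mk_le_aleph0_iff.1 (not_lt.1 hc)
  have h1 : μ univ = 0 := by
    rw [← Set.iUnion_of_singleton K]; exact measure_iUnion_null h.single
  simp at h1

theorem RVM.bdd (h : RVM K μ) [IsProbabilityMeasure μ] {ι : Type u} (hι : #ι < #K) (f : ι → K) :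
    ∃ b, ∀ i, f i < b := by
  by_contra! hc
  have h1 := h.add ι (fun i => Set.Iic (f i)) hι (fun i => h.Iic _)
  have h2 : (⋃ i, Set.Iic (f i)) = Set.univ := by
    refine eq_univ_of_forall fun x => ?_
    obtain ⟨i, hi⟩ := hc x
    exact mem_iUnion.2 ⟨i, hi⟩
  rw [h2] at h1
  simp at h1

theorem RVM.bdd_countable (h : RVM K μ) [IsProbabilityMeasure μ] {ι : Type*} [Countable ι]
    (f : ι → K) : ∃ b, ∀ i, f i < b := by
  by_contra! hc
  have h1 : μ (⋃ i, Set.Iic (f i)) = 0 := measure_iUnion_null (fun i => h.Iic _)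
  have h2 : (⋃ i, Set.Iic (f i)) = Set.univ := by
    refine eq_univ_of_forall fun x => ?_
    obtain ⟨i, hi⟩ := hc x
    exact mem_iUnion.2 ⟨i, hi⟩
  rw [h2] at h1
  simp at h1

theorem RVM.countable_range (h : RVM K μ) [IsProbabilityMeasure μ] {V : Type u} (hV : #V < #K)
    (f : K → V) : ∃ T : Set V, T.Countable ∧ μ (f ⁻¹' T)ᶜ = 0 := by
  refine ⟨{v | 0 < μ (f ⁻¹' {v})}, ?_, ?_⟩
  · refine Measure.countable_meas_pos_of_disjoint_iUnion (fun v => h.meas _) ?_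
    intro v w hvw
    exact (Set.disjoint_singleton.2 hvw).preimage f
  · have := h.add V (fun v => {x | f x = v ∧ μ (f ⁻¹' {v}) = 0}) hV ?_
    · refine measure_mono_null ?_ this
      intro x hx
      simp only [mem_compl_iff, mem_preimage, mem_ofPred_eq, not_lt, nonpos_iff_eq_zero] at hx
      exact mem_iUnion.2 ⟨f x, rfl, hx⟩
    · intro v
      by_cases hv : μ (f ⁻¹' {v}) = 0
      · exact measure_mono_null (fun x hx => hx.1) hv
      · simp [hv]

theorem RVM.joint (h : RVM K μ) [IsProbabilityMeasure μ] {Y : Type u} [MeasurableSpace Y]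
    {𝒱 : Set (Set Y)} (hV : #𝒱 < #K) (hm : ∀ s ∈ 𝒱, MeasurableSet s) {ι : Type*} [Countable ι]
    (f : ι → K → 𝒱) : ∃ X : Set K, μ Xᶜ = 0 ∧
      ∀ i, MeasurableSet {p : K × Y | p.1 ∈ X ∧ p.2 ∈ (f i p.1 : Set Y)} := by
  choose T hT1 hT2 using fun i => h.countable_range hV (f i)
  refine ⟨⋂ i, f i ⁻¹' T i, ?_, fun i => ?_⟩
  · rw [compl_iInter]
    exact measure_iUnion_null hT2
  · have : {p : K × Y | p.1 ∈ (⋂ i, f i ⁻¹' T i) ∧ p.2 ∈ (f i p.1 : Set Y)} =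
        ⋃ v ∈ T i, ((⋂ i, f i ⁻¹' T i) ∩ f i ⁻¹' {v}) ×ˢ (v : Set Y) := by
      ext p
      simp only [mem_ofPred_eq, mem_iUnion, mem_prod, mem_inter_iff, mem_preimage,
        mem_singleton_iff, exists_prop]
      constructor
      · rintro ⟨h1, h2⟩
        exact ⟨f i p.1, mem_iInter.1 h1 i, ⟨h1, rfl⟩, h2⟩
      · rintro ⟨v, hv, ⟨h1, h2⟩, h3⟩
        exact ⟨h1, h2 ▸ h3⟩
    rw [this]
    exact MeasurableSet.biUnion (hT1 i) fun v _ => (h.meas _).prod (hm _ v.2)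

end

section

variable {K : Type u} [MeasurableSpace K] [LinearOrder K] {μ : Measure K}

theorem RVM.nonnull_small (h : RVM K μ) [IsProbabilityMeasure μ] {Y : Type u}
    [mY : MeasurableSpace Y] (ν : Measure Y) [IsProbabilityMeasure ν]
    (𝒱 : Set (Set Y)) (hV : IsSetAlgebra 𝒱) (hgen : mY = MeasurableSpace.generateFrom 𝒱)
    (hcard : #𝒱 < #K) (i : K → Y) (hi : MeasurePreserving i μ ν) (K0 : Set K)
    (hK0 : μ K0ᶜ = 0) :
    ∃ α, ∀ M, MeasurableSet M → ν M = 0 → ∃ x, x < α ∧ x ∈ K0 ∧ i x ∉ M := by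
  have hVm : ∀ s ∈ 𝒱, MeasurableSet s := fun s hs => by
    rw [hgen]; exact MeasurableSpace.measurableSet_generateFrom hs
  by_contra! hc
  choose M hM hM0 hsub using hc
  choose U hU1 hU2 using fun α => outer_approx ν 𝒱 hV hgen (M α) (hM α) 2⁻¹ (by simp)
  obtain ⟨X, hX, hXm⟩ := h.joint hcard hVm (fun (n : ℕ) α => U α n)
  let P : Set (K × Y) := ⋃ n : ℕ, {p : K × Y | p.1 ∈ X ∧ p.2 ∈ (U p.1 n : Set Y)}
  have hP : MeasurableSet P := MeasurableSet.iUnion hXm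
  have h1 : (μ.prod ν) P ≤ 2⁻¹ := by
    rw [Measure.prod_apply hP]
    calc _ ≤ ∫⁻ _, 2⁻¹ ∂μ := by
          refine lintegral_mono fun α => ?_
          refine le_trans (measure_mono ?_) ((hU2 α).trans ?_)
          · intro y hy
            obtain ⟨n, hn⟩ := mem_iUnion.1 hy
            exact mem_iUnion.2 ⟨n, hn.2⟩
          · simp [hM0]
      _ = 2⁻¹ := by simp
  have h2 : (1 : ℝ≥0∞) ≤ (μ.prod ν) P := by
    rw [Measure.prod_apply_symm hP,
      ← hi.lintegral_comp (measurable_measure_prodMk_right hP)]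
    calc (1 : ℝ≥0∞) = ∫⁻ _, 1 ∂μ := by simp
      _ ≤ _ := by
        refine lintegral_mono_ae ?_
        have hae : ∀ᵐ a ∂μ, a ∈ K0 := hK0
        filter_upwards [hae] with a ha
        have h3 : μ (X ∩ Ioi a)ᶜ = 0 := by
          rw [compl_inter]
          refine measure_union_null hX ?_
          rw [compl_Ioi]; exact h.Iic a
        have h4 : μ (X ∩ Ioi a) = 1 := by
          rwa [prob_compl_eq_zero_iff (h.meas _)] at h3
        rw [← h4]
        refine measure_mono ?_
        rintro b ⟨hb1, hb2⟩
        have := hU1 b (hsub b a hb2 ha)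
        obtain ⟨n, hn⟩ := mem_iUnion.1 this
        exact mem_iUnion.2 ⟨n, hb1, hn⟩
  have := h2.trans h1
  norm_num at this

theorem RVM.core (h : RVM K μ) [IsProbabilityMeasure μ] {Y : Type u}
    [mY : MeasurableSpace Y] (ν : Measure Y) [IsProbabilityMeasure ν]
    (𝒱 : Set (Set Y)) (hgen : mY = MeasurableSpace.generateFrom 𝒱)
    (hcard : #𝒱 < #K) (i : K → Y) (hi : MeasurePreserving i μ ν)
    (e : K → ℕ → Bool) (he : Function.Injective e) (g : K → K → K)
    (hg : ∀ ζ ζ', ζ ≠ ζ' → μ {x | g ζ x = g ζ' x} = 0)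
    (U : K → ℕ → ℕ → ℕ → 𝒱) (G : K → ℕ → Set Y)
    (hG : ∀ ζ n, G ζ n = ⋂ j, ⋃ k, (U ζ n j k : Set Y))
    (Z : K → Set K) (hZ : ∀ ζ x, x ∈ Z ζ ↔ ∀ n, i x ∈ G ζ n ↔ e (g ζ x) n = true)
    (hZ0 : ∀ ζ, μ (Z ζ)ᶜ = 0) (α γ : K) (hγ : ∀ ζ x, x < α → g ζ x < γ)
    (hα : ∀ ζ M, MeasurableSet M → ν M = 0 → ∃ x, x < α ∧ x ∈ Z ζ ∧ i x ∉ M) : False := by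
  have hVm : ∀ s ∈ 𝒱, MeasurableSet s := fun s hs => by
    rw [hgen]; exact MeasurableSpace.measurableSet_generateFrom hs
  have hGm : ∀ ζ n, MeasurableSet (G ζ n) := fun ζ n => by
    rw [hG]
    exact MeasurableSet.iInter fun j => MeasurableSet.iUnion fun k => hVm _ (U ζ n j k).2
  obtain ⟨X, hX, hXm⟩ := h.joint hcard hVm (fun (t : ℕ × ℕ × ℕ) ζ => U ζ t.1 t.2.1 t.2.2)
  let D : ℕ → Set (K × Y) := fun n => {p | p.1 ∈ X ∧ p.2 ∈ G p.1 n}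
  have hD : ∀ n, MeasurableSet (D n) := by
    intro n
    have : D n = ⋂ j, ⋃ k, {p : K × Y | p.1 ∈ X ∧ p.2 ∈ (U p.1 n j k : Set Y)} := by
      ext p
      simp only [D, hG, mem_ofPred_eq, mem_iInter, mem_iUnion]
      constructor
      · rintro ⟨h1, h2⟩ j
        obtain ⟨k, hk⟩ := h2 j
        exact ⟨k, h1, hk⟩
      · intro h1
        refine ⟨(h1 0).choose_spec.1, fun j => ?_⟩
        obtain ⟨k, hk⟩ := h1 j
        exact ⟨k, hk.2⟩
    rw [this]
    exact MeasurableSet.iInter fun j => MeasurableSet.iUnion fun k => hXm (n, j, k)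
  let p1 : (K × K) × Y → K × Y := fun q => (q.1.1, q.2)
  let p2 : (K × K) × Y → K × Y := fun q => (q.1.2, q.2)
  have hp1 : Measurable p1 := by fun_prop
  have hp2 : Measurable p2 := by fun_prop
  let C : Set ((K × K) × Y) := ((X ×ˢ X) ×ˢ Set.univ) ∩
    ⋂ n, ((p1 ⁻¹' D n ∩ p2 ⁻¹' D n) ∪ ((p1 ⁻¹' D n)ᶜ ∩ (p2 ⁻¹' D n)ᶜ))
  have hC : MeasurableSet C := by
    refine MeasurableSet.inter (((h.meas _).prod (h.meas _)).prod MeasurableSet.univ) ?_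
    refine MeasurableSet.iInter fun n => ?_
    exact ((hp1 (hD n)).inter (hp2 (hD n))).union
      ((hp1 (hD n)).compl.inter (hp2 (hD n)).compl)
  have hCmem : ∀ ζ ζ' y, ((ζ, ζ'), y) ∈ C ↔ (ζ ∈ X ∧ ζ' ∈ X) ∧ ∀ n, (y ∈ G ζ n ↔ y ∈ G ζ' n) := by
    intro ζ ζ' y
    simp only [C, D, p1, p2, mem_inter_iff, mem_prod, mem_univ, mem_iInter, mem_union,
      mem_preimage, mem_compl_iff, mem_ofPred_eq, and_true]
    refine and_congr_right fun hh => forall_congr' fun n => ?_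
    simp only [hh.1, hh.2, true_and]
    tauto
  have hC0 : ((μ.prod μ).prod ν) C = 0 := by
    rw [Measure.prod_apply hC, lintegral_prod _ (measurable_measure_prodMk_left hC).aemeasurable]
    rw [← lintegral_zero (μ := μ)]
    congr 1
    ext ζ
    rw [← lintegral_zero (μ := μ)]
    refine lintegral_congr_ae ?_
    have hne : ∀ᵐ ζ' ∂μ, ζ' ≠ ζ := by
      have := h.single ζ
      rw [ae_iff]; simpa using this
    filter_upwards [hne] with ζ' hζ'
    rw [← hi.measure_preimage ((measurable_prodMk_left hC).nullMeasurableSet)]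
    refine measure_mono_null ?_
      (measure_union_null (measure_union_null (hZ0 ζ) (hZ0 ζ')) (hg ζ ζ' hζ'.symm))
    intro x hx
    by_contra hcon
    simp only [mem_union, mem_compl_iff, mem_ofPred_eq, not_or, not_not] at hcon
    obtain ⟨⟨h1, h2⟩, h3⟩ := hcon
    have h4 := ((hCmem _ _ _).1 hx).2
    refine h3 (he (funext fun n => ?_))
    rw [Bool.eq_iff_iff, ← (hZ _ _).1 h1 n, ← (hZ _ _).1 h2 n]
    exact h4 n
  let W : Set Y := {y | (μ.prod μ) ((fun p => (p, y)) ⁻¹' C) ≠ 0}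
  have hmeas := measurable_measure_prodMk_right (μ := μ.prod μ) hC
  have hW : MeasurableSet W := hmeas (measurableSet_singleton 0).compl
  have hW0 : ν W = 0 := by
    rw [Measure.prod_apply_symm hC, lintegral_eq_zero_iff hmeas] at hC0
    exact hC0
  obtain ⟨x, hxα, hxW, hx⟩ : ∃ x, x < α ∧ i x ∉ W ∧ μ {ζ | x ∈ Z ζ} ≠ 0 := by
    by_contra! hcon
    have h1 := h.add {x : K // x < α ∧ i x ∉ W} (fun x => {ζ | x.1 ∈ Z ζ})
      ((Cardinal.mk_le_mk_of_subset (s := {x : K | x < α ∧ i x ∉ W}) (t := Set.Iio α)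
        (fun x hx => hx.1)).trans_lt (h.seg α))
      (fun x => hcon x.1 x.2.1 x.2.2)
    have h2 : (⋃ x : {x : K // x < α ∧ i x ∉ W}, {ζ | x.1 ∈ Z ζ}) = Set.univ := by
      refine eq_univ_of_forall fun ζ => ?_
      obtain ⟨x, h1, h2, h3⟩ := hα ζ W hW hW0
      exact mem_iUnion.2 ⟨⟨x, h1, h3⟩, h2⟩
    rw [h2] at h1
    simp at h1
  obtain ⟨η, hη⟩ : ∃ η : K, μ {ζ | x ∈ Z ζ ∧ g ζ x = η} ≠ 0 := by
    by_contra! hcon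
    have h1 := h.add (Set.Iio γ) (fun η => {ζ | x ∈ Z ζ ∧ g ζ x = η.1}) (h.seg γ)
      (fun η => hcon η)
    refine hx (measure_mono_null ?_ h1)
    intro ζ hζ
    exact mem_iUnion.2 ⟨⟨g ζ x, hγ ζ x hxα⟩, hζ, rfl⟩
  set E := {ζ | x ∈ Z ζ ∧ g ζ x = η} with hE
  have hEX : μ (E ∩ X) ≠ 0 := by
    intro h0
    refine hη (measure_mono_null ?_ (measure_union_null h0 hX))
    intro ζ hζ
    by_cases hz : ζ ∈ X
    · exact Or.inl ⟨hζ, hz⟩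
    · exact Or.inr hz
  refine hxW ?_
  intro h0
  have h1 : (μ.prod μ) ((E ∩ X) ×ˢ (E ∩ X)) = 0 := by
    refine measure_mono_null ?_ h0
    rintro ⟨ζ, ζ'⟩ ⟨⟨⟨a1, a2⟩, a3⟩, ⟨⟨b1, b2⟩, b3⟩⟩
    refine (hCmem _ _ _).2 ⟨⟨a3, b3⟩, fun n => ?_⟩
    have a4 := (hZ _ _).1 a1 n
    have b4 := (hZ _ _).1 b1 n
    simp only at a2 b2
    rw [a4, b4, a2, b2]
  rw [Measure.prod_prod] at h1
  simp [hEX] at h1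

end

section

variable {K : Type u} [MeasurableSpace K] [LinearOrder K] {μ : Measure K}

theorem RVM.coding (h : RVM K μ) [IsProbabilityMeasure μ]
    (hat : ∀ A : Set K, 0 < μ A → ∃ B ⊆ A, 0 < μ B ∧ μ B < μ A) :
    ∃ e : K → ℕ → Bool, Function.Injective e := by
  have step : ∀ A : Set K, 0 < μ A → ∃ B ⊆ A, 0 < μ B ∧ μ B ≤ μ A / 2 := by
    intro A hA
    obtain ⟨B, hBA, hB0, hB⟩ := hat A hA
    have hsum : μ B + μ (A \ B) = μ A := by
      have := measure_inter_add_sdiff (μ := μ) A (h.meas B)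
      rwa [inter_eq_self_of_subset_right hBA] at this
    rcases le_or_gt (μ B) (μ A / 2) with h1 | h1
    · exact ⟨B, hBA, hB0, h1⟩
    · refine ⟨A \ B, sdiff_subset, ?_, ?_⟩
      · rw [pos_iff_ne_zero]
        intro h0
        rw [h0, add_zero] at hsum
        exact hB.ne hsum
      · by_contra! h2
        have := ENNReal.add_lt_add h1 h2
        rw [hsum, ENNReal.add_halves] at this
        exact lt_irrefl _ this
  have small : ∀ n : ℕ, ∀ A : Set K, 0 < μ A → ∃ B ⊆ A, 0 < μ B ∧ μ B ≤ 2⁻¹ ^ n := by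
    intro n
    induction n with
    | zero => exact fun A hA => ⟨A, Subset.rfl, hA, by simpa using prob_le_one⟩
    | succ n ih =>
      intro A hA
      obtain ⟨B, hBA, hB0, hB⟩ := ih A hA
      obtain ⟨C, hCB, hC0, hC⟩ := step B hB0
      refine ⟨C, hCB.trans hBA, hC0, hC.trans ?_⟩
      rw [pow_succ, div_eq_mul_inv]
      gcongr
  have cover : ∀ n : ℕ, ∃ f : ℕ → Set K, (∀ k, μ (f k) ≤ 2⁻¹ ^ n) ∧ μ (⋃ k, f k)ᶜ = 0 := by
    intro n
    let S : Set (Set K) := {A | ∃ f : ℕ → Set K, A = ⋃ k, f k ∧ ∀ k, μ (f k) ≤ 2⁻¹ ^ n}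
    have hS : ∀ F : ℕ → Set K, (∀ k, F k ∈ S) → (⋃ k, F k) ∈ S := by
      intro F hF
      choose f hf1 hf2 using hF
      refine ⟨fun k => f k.unpair.1 k.unpair.2, ?_, fun k => hf2 _ _⟩
      ext x
      simp only [hf1, mem_iUnion]
      constructor
      · rintro ⟨a, b, hab⟩
        exact ⟨Nat.pair a b, by simpa using hab⟩
      · rintro ⟨k, hk⟩
        exact ⟨_, _, hk⟩
    have hemp : (∅ : Set K) ∈ S := ⟨fun _ => ∅, by simp, by simp⟩
    have hne : (μ '' S).Nonempty := by
      refine ⟨μ ∅, ?_⟩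
      exact mem_image_of_mem _ hemp
    obtain ⟨u, -, hu, huS⟩ := exists_seq_tendsto_sSup hne (OrderTop.bddAbove _)
    choose F hFS hFu using huS
    have hA := hS F hFS
    have hge : sSup (μ '' S) ≤ μ (⋃ k, F k) := by
      refine le_of_tendsto' hu fun k => ?_
      rw [← hFu k]
      exact measure_mono (subset_iUnion _ k)
    obtain ⟨f, hf1, hf2⟩ := id hA
    refine ⟨f, hf2, ?_⟩
    rw [← hf1]
    by_contra hpos
    obtain ⟨B, hBA, hB0, hB⟩ := small n _ (pos_iff_ne_zero.2 hpos)
    have hBS : B ∈ S := ⟨fun _ => B, by simp [iUnion_const], fun _ => hB⟩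
    have hU : (⋃ k, F k) ∪ B ∈ S := by
      have := hS (fun k => if k = 0 then ⋃ k, F k else B) (by
        intro k
        by_cases hk : k = 0
        · simpa [hk] using hA
        · simpa [hk] using hBS)
      convert this using 1
      ext x
      simp only [mem_union, mem_iUnion]
      constructor
      · rintro (hx | hx)
        · exact ⟨0, by simpa using hx⟩
        · exact ⟨1, by simpa using hx⟩
      · rintro ⟨k, hk⟩
        by_cases hk0 : k = 0
        · left; simpa [hk0] using hk
        · right; simpa [hk0] using hk
    have h1 : μ ((⋃ k, F k) ∪ B) = μ (⋃ k, F k) + μ B :=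
      measure_union (disjoint_left.2 fun x hx hxB => hBA hxB hx) (h.meas _)
    have h2 : μ ((⋃ k, F k) ∪ B) ≤ μ (⋃ k, F k) := (le_sSup (mem_image_of_mem μ hU)).trans hge
    rw [h1] at h2
    exact absurd h2 (not_le.2 (ENNReal.lt_add_right (measure_ne_top _ _) hB0.ne'))
  choose f hf1 hf2 using cover
  have hle : #K ≤ #(ULift.{u} (ℕ → ℕ)) := by
    by_contra hlt
    have h1 := h.add (ULift.{u} (ℕ → ℕ)) (fun s => ⋂ n, f n (s.down n)) (not_le.1 hlt) (by
      intro s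
      have ht : Tendsto (fun n : ℕ => (2⁻¹ : ℝ≥0∞) ^ n) atTop (nhds 0) :=
        ENNReal.tendsto_pow_atTop_nhds_zero_of_lt_one (by simp)
      refine le_antisymm (ge_of_tendsto' ht fun n => ?_) zero_le
      exact (measure_mono (iInter_subset _ n)).trans (hf1 n _))
    have h2 : μ (⋃ n, (⋃ k, f n k)ᶜ) = 0 := measure_iUnion_null hf2
    have h3 : μ Set.univ = 0 := by
      refine measure_mono_null ?_ (measure_union_null h1 h2)
      intro x _
      by_cases hx : ∀ n, ∃ k, x ∈ f n k
      · choose s hs using hx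
        exact Or.inl (mem_iUnion.2 ⟨⟨s⟩, mem_iInter.2 hs⟩)
      · push Not at hx
        obtain ⟨n, hn⟩ := hx
        exact Or.inr (mem_iUnion.2 ⟨n, by simpa using hn⟩)
    simp at h3
  have hle2 : #K ≤ #(ULift.{u} (ℕ → Bool)) := by
    refine hle.trans (le_of_eq ?_)
    simp
  obtain ⟨e⟩ := hle2
  exact ⟨fun x => (e x).down, fun x y hxy => e.injective (ULift.down_injective hxy)⟩

theorem RVM.family (h : RVM K μ) [IsProbabilityMeasure μ] :
    ∃ F : Set (K → K), #K < #F ∧ F.Pairwise fun f g => μ {x | f x = g x} = 0 := by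
  let S : Set (Set (K → K)) := {F | F.Pairwise fun f g => μ {x | f x = g x} = 0}
  obtain ⟨F, hF⟩ := zorn_subset S (by
    intro c hc hchain
    refine ⟨⋃₀ c, ?_, fun s hs => subset_sUnion_of_mem hs⟩
    exact (pairwise_sUnion hchain.directedOn).2 fun s hs => hc hs)
  refine ⟨F, ?_, hF.prop⟩
  by_contra hle
  obtain ⟨j⟩ := not_lt.1 hle
  have hex : ∀ x : K, ∃ y : K, ∀ f : F, j f < x → f.1 x ≠ y := by
    intro x
    by_contra! hcon
    choose f hf1 hf2 using hcon
    have : #K ≤ #(Set.Iio x) :=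
      Cardinal.mk_le_of_injective (f := fun y => (⟨j (f y), hf1 y⟩ : Set.Iio x)) (by
        intro y y' hy
        have h1 : f y = f y' := j.injective (congrArg Subtype.val hy)
        rw [← hf2 y, ← hf2 y', h1])
    exact absurd (h.seg x) (not_lt.2 this)
  choose g hg using hex
  have hgf : ∀ f ∈ F, μ {x | g x = f x} = 0 := by
    intro f hf
    refine measure_mono_null ?_ (h.Iic (j ⟨f, hf⟩))
    intro x hx
    by_contra hlt
    exact hg x ⟨f, hf⟩ (not_le.1 hlt) (Eq.symm hx)
  have hins : insert g F ∈ S := by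
    refine Set.Pairwise.insert hF.prop fun f hf _ => ⟨hgf f hf, ?_⟩
    have := hgf f hf
    simpa only [eq_comm] using this
  have hgF : g ∈ F := hF.le_of_ge hins (subset_insert _ _) (mem_insert _ _)
  have := hgf g hgF
  simp at this

theorem RVM.bounded_generate (h : RVM K μ) [IsProbabilityMeasure μ] (A : K → Set K) (M : Set K)
    (hM : MeasurableSet[MeasurableSpace.generateFrom (range A)] M) :
    ∃ β, ∀ b, β ≤ b → MeasurableSet[MeasurableSpace.generateFrom (A '' Set.Iio b)] M := by
  induction M, hM using MeasurableSpace.generateFrom_induction with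
  | hC t ht _ =>
    obtain ⟨x, rfl⟩ := ht
    obtain ⟨b, hb⟩ := h.bdd_countable (fun _ : Unit => x)
    exact ⟨b, fun c hc => MeasurableSpace.measurableSet_generateFrom
      ⟨x, (hb ()).trans_le hc, rfl⟩⟩
  | empty =>
    obtain ⟨b, hb⟩ := h.bdd_countable (fun k : Empty => k.elim)
    exact ⟨b, fun _ _ => MeasurableSpace.measurableSet_empty _⟩
  | compl t ht ih =>
    obtain ⟨b, hb⟩ := ih
    exact ⟨b, fun c hc => MeasurableSet.compl (hb c hc)⟩
  | iUnion s hs ih =>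
    choose b hb using ih
    obtain ⟨c, hc⟩ := h.bdd_countable b
    exact ⟨c, fun d hd => MeasurableSet.iUnion fun n => hb n d ((hc n).le.trans hd)⟩

theorem RVM.gitik_shelah (h : RVM K μ) [IsProbabilityMeasure μ]
    (hat : ∀ A : Set K, 0 < μ A → ∃ B ⊆ A, 0 < μ B ∧ μ B < μ A) (A : K → Set K) :
    ∃ B : Set K, ∀ M, MeasurableSet[MeasurableSpace.generateFrom (range A)] M → ¬ M =ᵐ[μ] B := by
  by_contra! hcon
  obtain ⟨e, he⟩ := h.coding hat
  obtain ⟨F, hFc, hF⟩ := h.family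
  let V : K → Set (Set K) := fun β => generateSetAlgebra (A '' Set.Iio β)
  have hVcard : ∀ β, #(V β) < #K := fun β =>
    exists_small_algebra _ _ h.aleph0_lt (Cardinal.mk_image_le.trans_lt (h.seg β))
  have hle : ∀ β, MeasurableSpace.generateFrom (V β) ≤ ‹MeasurableSpace K› :=
    fun β s _ => h.meas s
  let ν : ∀ β, @Measure K (MeasurableSpace.generateFrom (V β)) := fun β => μ.trim (hle β)
  have hν : ∀ β, @IsProbabilityMeasure K (MeasurableSpace.generateFrom (V β)) (ν β) :=
    fun β => @IsProbabilityMeasure.mk K (MeasurableSpace.generateFrom (V β)) (ν β) (by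
      show μ.trim (hle β) Set.univ = 1
      rw [trim_measurableSet_eq (hle β) (@MeasurableSet.univ K (MeasurableSpace.generateFrom (V β)))]
      exact measure_univ)
  have hid : ∀ β, @MeasurePreserving K K _ (MeasurableSpace.generateFrom (V β)) id μ (ν β) :=
    fun β => @MeasurePreserving.mk K K _ (MeasurableSpace.generateFrom (V β)) id μ (ν β)
      (measurable_id'' (hle β)) (trim_eq_map (hle β)).symm
  have hAlg : ∀ β, IsSetAlgebra (V β) := fun β => isSetAlgebra_generateSetAlgebra
  have key : ∀ f : K → K, ∃ t : K × K × K, ∃ U : ℕ → ℕ → ℕ → V t.1,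
      μ {x | ∀ n, x ∈ (⋂ j, ⋃ k, (U n j k : Set K)) ↔ e (f x) n = true}ᶜ = 0 ∧
      (∀ x, x < t.2.1 → f x < t.2.2) ∧
      ∀ M, MeasurableSet[MeasurableSpace.generateFrom (V t.1)] M → ν t.1 M = 0 →
        ∃ x, x < t.2.1 ∧ x ∈ {x | ∀ n, x ∈ (⋂ j, ⋃ k, (U n j k : Set K)) ↔ e (f x) n = true} ∧
          id x ∉ M := by
    intro f
    choose M hM1 hM2 using fun n : ℕ => hcon {x | e (f x) n = true}
    choose b hb using fun n => h.bounded_generate A (M n) (hM1 n)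
    obtain ⟨β, hβ⟩ := h.bdd_countable b
    have hM3 : ∀ n, MeasurableSet[MeasurableSpace.generateFrom (V β)] (M n) := by
      intro n
      show MeasurableSet[MeasurableSpace.generateFrom (generateSetAlgebra (A '' Set.Iio β))] _
      rw [generateFrom_generateSetAlgebra_eq]
      exact hb n β (hβ n).le
    have := hν β
    choose U hU using fun n => gdelta_approx (mY := MeasurableSpace.generateFrom (V β))
      (ν β) (V β) (hAlg β) rfl (M n) (hM3 n)
    have hZ : μ {x | ∀ n, x ∈ (⋂ j, ⋃ k, (U n j k : Set K)) ↔ e (f x) n = true}ᶜ = 0 := by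
      have h1 : ∀ᵐ x ∂μ, ∀ n, x ∈ (⋂ j, ⋃ k, (U n j k : Set K)) ↔ e (f x) n = true := by
        rw [ae_all_iff]
        intro n
        have h2 := (ae_eq_of_ae_eq_trim (hU n)).trans (hM2 n)
        exact h2.mem_iff
      exact h1
    obtain ⟨α, hα⟩ := h.nonnull_small (mY := MeasurableSpace.generateFrom (V β)) (ν β) (V β)
      (hAlg β) rfl (hVcard β) id (hid β) _ hZ
    obtain ⟨γ, hγ⟩ := h.bdd (h.seg α) (fun x => f x.1)
    exact ⟨(β, α, γ), U, hZ, fun x hx => hγ ⟨x, hx⟩, hα⟩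
  choose t U hU1 hU2 hU3 using key
  have hK0 : ℵ₀ ≤ #K := h.aleph0_lt.le
  have hcard : #(K × K × K) = #K := by
    simp [Cardinal.mul_eq_self hK0]
  obtain ⟨⟨β, α, γ⟩, hfib⟩ := Cardinal.infinite_pigeonhole_card_lt (fun f : F => t f.1)
    (by rw [hcard]; exact hFc) (hK0.trans hFc.le)
  rw [hcard] at hfib
  obtain ⟨φ⟩ := hfib.le
  have hφ : ∀ ζ, t (φ ζ).1.1 = (β, α, γ) := fun ζ => (φ ζ).2
  have key2 : ∀ ζ, ∃ U : ℕ → ℕ → ℕ → V β,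
      μ {x | ∀ n, x ∈ (⋂ j, ⋃ k, (U n j k : Set K)) ↔ e ((φ ζ).1.1 x) n = true}ᶜ = 0 ∧
      (∀ x, x < α → (φ ζ).1.1 x < γ) ∧
      ∀ M, MeasurableSet[MeasurableSpace.generateFrom (V β)] M → ν β M = 0 →
        ∃ x, x < α ∧ x ∈ {x | ∀ n, x ∈ (⋂ j, ⋃ k, (U n j k : Set K)) ↔
          e ((φ ζ).1.1 x) n = true} ∧ id x ∉ M := by
    intro ζ
    have h1 := hU1 (φ ζ).1.1
    have h2 := hU2 (φ ζ).1.1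
    have h3 := hU3 (φ ζ).1.1
    rw [hφ ζ] at h2
    generalize U (φ ζ).1.1 = U' at h1 h3
    revert U'
    rw [hφ ζ]
    intro U' h1 h3
    exact ⟨U', h1, h2, h3⟩
  choose U' hU1' hU2' hU3' using key2
  have := hν β
  exact h.core (mY := MeasurableSpace.generateFrom (V β)) (ν β) (V β) rfl (hVcard β) id (hid β)
    e he (fun ζ => (φ ζ).1.1)
    (fun ζ ζ' hne => hF (φ ζ).1.2 (φ ζ').1.2 (fun hh => hne (φ.injective
      (Subtype.ext (Subtype.ext hh)))))
    U' (fun ζ n => ⋂ j, ⋃ k, (U' ζ n j k : Set K)) (fun _ _ => rfl)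
    (fun ζ => {x | ∀ n, x ∈ (⋂ j, ⋃ k, (U' ζ n j k : Set K)) ↔ e ((φ ζ).1.1 x) n = true})
    (fun ζ x => Iff.rfl) hU1' α γ hU2' hU3'

end

theorem exists_proj {K : Type u} {m mK : MeasurableSpace K} (hle : m ≤ mK) (μ : Measure K)
    [IsFiniteMeasure μ] (B : Set K) : ∃ g : K → ℝ≥0∞, Measurable[m] g ∧
      ∀ M, MeasurableSet[m] M → μ.withDensity g M = μ.restrict B M := by
  have hac : (μ.restrict B).trim hle ≪ μ.trim hle := Measure.AbsolutelyContinuous.trim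
    Measure.absolutelyContinuous_restrict hle
  have hg : Measurable[m] (((μ.restrict B).trim hle).rnDeriv (μ.trim hle)) :=
    Measure.measurable_rnDeriv ((μ.restrict B).trim hle) (μ.trim hle)
  refine ⟨((μ.restrict B).trim hle).rnDeriv (μ.trim hle), hg, ?_⟩
  intro M hM
  rw [withDensity_apply _ (hle _ hM), ← trim_measurableSet_eq (μ := μ.restrict B) hle hM]
  conv_rhs => rw [← Measure.withDensity_rnDeriv_eq ((μ.restrict B).trim hle) (μ.trim hle) hac]
  rw [withDensity_apply _ hM, restrict_trim hle _ hM, lintegral_trim hle hg]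

theorem RVM.two_measures {K : Type u} [mK : MeasurableSpace K] [LinearOrder K] {μ : Measure K}
    (h : RVM K μ) [IsProbabilityMeasure μ]
    (hat : ∀ A : Set K, 0 < μ A → ∃ B ⊆ A, 0 < μ B ∧ μ B < μ A) (A : K → Set K) :
    ∃ μ1 μ0 : Measure K, μ1 Set.univ = 2⁻¹ ∧ μ0 Set.univ = 2⁻¹ ∧
      (∀ i, μ1 (A i) = μ0 (A i)) ∧ ∃ B, μ1 B ≠ μ0 B := by
  obtain ⟨B, hB⟩ := h.gitik_shelah hat A
  have hle : MeasurableSpace.generateFrom (range A) ≤ mK := fun s _ => h.meas s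
  let ν : Measure K := μ.restrict B
  obtain ⟨g, hg, hgm⟩ := exists_proj hle μ B
  have hB0 : μ B ≠ 0 := by
    intro h0
    exact hB ∅ (@MeasurableSet.empty _ (MeasurableSpace.generateFrom (range A))) (ae_eq_empty.2 h0).symm
  have hBt : μ B ≠ ∞ := measure_ne_top _ _
  have hc : (2 * μ B)⁻¹ * μ B = 2⁻¹ := by
    rw [ENNReal.mul_inv (by simp) (by simp), mul_assoc, ENNReal.inv_mul_cancel hB0 hBt, mul_one]
  have hν : ν Set.univ = μ B := by simp [ν]
  refine ⟨(2 * μ B)⁻¹ • ν, (2 * μ B)⁻¹ • μ.withDensity g, ?_, ?_, ?_, ?_⟩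
  · simp [hν, hc]
  · rw [Measure.smul_apply, hgm _ (@MeasurableSet.univ _ (MeasurableSpace.generateFrom (range A))), hν, smul_eq_mul, hc]
  · intro i
    rw [Measure.smul_apply, Measure.smul_apply,
      hgm _ (MeasurableSpace.measurableSet_generateFrom ⟨i, rfl⟩)]
  · by_contra! hcon
    have hc0 : (2 * μ B)⁻¹ ≠ 0 := by
      rw [Ne, ENNReal.inv_eq_zero]; exact ENNReal.mul_ne_top (by simp) hBt
    have hct : (2 * μ B)⁻¹ ≠ ∞ := by
      simp [hB0]
    have heq : ∀ C, ν C = μ.withDensity g C := by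
      intro C
      have := hcon C
      rw [Measure.smul_apply, Measure.smul_apply, smul_eq_mul, smul_eq_mul] at this
      exact (ENNReal.mul_right_inj hc0 hct).1 this
    have hgK : Measurable g := hg.mono hle le_rfl
    let Z : Set K := g ⁻¹' {0}
    have hZ : MeasurableSet[MeasurableSpace.generateFrom (range A)] Z := hg (measurableSet_singleton 0)
    have h1 : ∀ᵐ x ∂μ, x ∈ Bᶜ → g x = 0 := by
      have h2 : μ.withDensity g Bᶜ = 0 := by
        rw [← heq]; simp [ν, Measure.restrict_apply (h.meas _)]
      rw [withDensity_apply _ (h.meas _), lintegral_eq_zero_iff hgK] at h2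
      exact (ae_restrict_iff' (h.meas _)).1 h2
    have h3 : ∀ᵐ x ∂μ, ¬ (x ∈ Z ∧ x ∈ B) := by
      have h2 : ν Z = 0 := by
        rw [heq, withDensity_apply _ (h.meas _), lintegral_eq_zero_iff hgK]
        exact (ae_restrict_iff' (h.meas _)).2 (Eventually.of_forall fun x hx => hx)
      rw [Measure.restrict_apply (h.meas _)] at h2
      rw [ae_iff]
      simpa using h2
    refine hB Zᶜ hZ.compl ?_
    filter_upwards [h1, h3] with x hx1 hx3
    refine propext ⟨fun hx => ?_, fun hx hz => hx3 ⟨hz, hx⟩⟩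
    by_contra hxB
    exact hx (hx1 hxB)

theorem RVM.exists_sep {Ω : Type u} [MetricSpace Ω] {K : Type u} [MeasurableSpace K]
    [LinearOrder K] {μ : Measure K} (h : RVM K μ) [IsProbabilityMeasure μ]
    (hd : #K ≤ densityCard Ω) :
    ∃ ε > 0, ∃ ι : K → Ω, ∀ x y, x ≠ y → ε ≤ dist (ι x) (ι y) := by
  have hmax : ∀ n : ℕ, ∃ D : Set Ω,
      (D.Pairwise fun x y => 1 / ((n : ℝ) + 1) ≤ dist x y) ∧
      ∀ z, ∃ y ∈ D, dist z y < 1 / ((n : ℝ) + 1) := by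
    intro n
    let S : Set (Set Ω) := {D | D.Pairwise fun x y => 1 / ((n : ℝ) + 1) ≤ dist x y}
    obtain ⟨D, hD⟩ := zorn_subset S (by
      intro c hc hchain
      refine ⟨⋃₀ c, ?_, fun s hs => subset_sUnion_of_mem hs⟩
      exact (pairwise_sUnion hchain.directedOn).2 fun s hs => hc hs)
    refine ⟨D, hD.prop, fun z => ?_⟩
    by_contra! hcon
    have hins : insert z D ∈ S := by
      refine Set.Pairwise.insert hD.prop fun f hf _ => ⟨hcon f hf, ?_⟩
      rw [dist_comm]; exact hcon f hf
    have hz : z ∈ D := hD.le_of_ge hins (subset_insert _ _) (mem_insert _ _)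
    have := hcon z hz
    rw [dist_self] at this
    exact absurd this (not_le.2 (by positivity))
  choose D hD1 hD2 using hmax
  have hdense : Dense (⋃ n, D n) := by
    rw [Metric.dense_iff]
    intro x r hr
    obtain ⟨n, hn⟩ := exists_nat_one_div_lt hr
    obtain ⟨y, hy, hxy⟩ := hD2 n x
    exact ⟨y, by rw [Metric.mem_ball, dist_comm]; exact hxy.trans hn, mem_iUnion.2 ⟨n, hy⟩⟩
  have hcard : #K ≤ #(⋃ n, D n : Set Ω) := hd.trans (csInf_le' ⟨_, hdense, rfl⟩)
  obtain ⟨j⟩ := hcard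
  have hex : ∃ n, #K ≤ #(D n) := by
    by_contra! hcon
    have h1 : ∀ n, μ {x | (j x).1 ∈ D n} = 0 := by
      intro n
      refine h.small _ (lt_of_le_of_lt ?_ (hcon n))
      exact Cardinal.mk_le_of_injective
        (f := fun x : {x | (j x).1 ∈ D n} => (⟨(j x.1).1, x.2⟩ : D n)) (by
          intro x y hxy
          have hxy2 : (j x.1).1 = (j y.1).1 := Subtype.mk.inj hxy
          exact Subtype.ext (j.injective (Subtype.ext hxy2)))
    have h2 : μ Set.univ = 0 := by
      refine measure_mono_null ?_ (measure_iUnion_null h1)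
      intro x _
      obtain ⟨n, hn⟩ := mem_iUnion.1 (j x).2
      exact mem_iUnion.2 ⟨n, hn⟩
    simp at h2
  obtain ⟨n, ⟨φ⟩⟩ := hex
  exact ⟨1 / ((n : ℝ) + 1), by positivity, fun x => (φ x).1, fun x y hxy =>
    hD1 n (φ x).2 (φ y).2 fun hh => hxy (φ.injective (Subtype.ext hh))⟩

theorem isClosed_image_of_sep {Ω : Type u} [MetricSpace Ω] {K : Type u} {ε : ℝ} (hε : 0 < ε)
    {ι : K → Ω} (hι : ∀ x y, x ≠ y → ε ≤ dist (ι x) (ι y)) (s : Set K) : IsClosed (ι '' s) := by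
  refine Metric.isClosed_of_pairwise_le_dist hε ?_
  rintro _ ⟨x, -, rfl⟩ _ ⟨y, -, rfl⟩ hxy
  exact hι x y fun hh => hxy (by rw [hh])

theorem exists_rvm (τ : Cardinal.{u}) (hτ : IsAtomlesslyMeasurableCardinal τ) :
    ∃ (K : Type u) (_ : MeasurableSpace K) (_ : LinearOrder K) (μ : Measure K),
      #K = τ ∧ RVM K μ ∧ IsProbabilityMeasure μ ∧
        ∀ A : Set K, 0 < μ A → ∃ B ⊆ A, 0 < μ B ∧ μ B < μ A := by
  obtain ⟨μ, h1, h2, h3, h4⟩ := hτ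
  obtain ⟨lo, wf, ho⟩ := Cardinal.exists_ord_eq_type_lt τ.out
  let mK : MeasurableSpace τ.out := ⊤
  refine ⟨τ.out, mK, lo, μ, Cardinal.mk_out τ, ⟨fun _ => trivial, ?_, h2, ?_⟩, ⟨h1⟩, h3⟩
  · intro ι N hι hN
    rw [← sUnion_range]
    refine h4 _ (Cardinal.mk_range_le.trans_lt (by rwa [Cardinal.mk_out] at hι)) ?_
    rintro _ ⟨i, rfl⟩
    exact hN i
  · intro x
    exact Cardinal.mk_Iio_lt x ho

/-- The k-NN label as a function of the distances and labels. -/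
def Lab (n k : ℕ) (s : Fin n → ℝ × Bool) (π : Equiv.Perm (Fin n)) : Bool :=
  decide (k ≤ 2 * Set.ncard {i ∈ {i | Set.ncard {j | (s j).1 < (s i).1 ∨
    ((s j).1 = (s i).1 ∧ π j < π i)} < k} | (s i).2 = true})

theorem kNNLabel_eq_Lab {Ω : Type u} [MetricSpace Ω] (n k : ℕ) (σ : Fin n → Ω × Bool)
    (π : Equiv.Perm (Fin n)) (x : Ω) :
    kNNLabel n k σ π x = Lab n k (fun i => (dist x (σ i).1, (σ i).2)) π := rfl

theorem ncard_rank {n k : ℕ} (hk : k ≤ n) (r : Fin n → Fin n → Prop)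
    (hirr : ∀ i, ¬ r i i) (htr : ∀ i j l, r i j → r j l → r i l)
    (htot : ∀ i j, i ≠ j → r i j ∨ r j i) :
    Set.ncard {i | Set.ncard {j | r j i} < k} = k := by
  have hlt : ∀ i, Set.ncard {j | r j i} < n := by
    intro i
    have : Set.ncard {j | r j i} < Set.ncard (Set.univ : Set (Fin n)) := by
      refine Set.ncard_lt_ncard ⟨subset_univ _, fun hh => ?_⟩ (Set.toFinite _)
      exact hirr i (hh (mem_univ i))
    simpa [Set.ncard_univ] using this
  let f : Fin n → Fin n := fun i => ⟨_, hlt i⟩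
  have hmono : ∀ i j, r i j → f i < f j := by
    intro i j hij
    show Set.ncard _ < Set.ncard _
    refine Set.ncard_lt_ncard ⟨fun l hl => htr _ _ _ hl hij, fun hh => ?_⟩ (Set.toFinite _)
    exact hirr i (hh hij)
  have hinj : Function.Injective f := by
    intro i j hij
    by_contra hne
    rcases htot i j hne with h1 | h1
    · exact (hmono _ _ h1).ne hij
    · exact (hmono _ _ h1).ne hij.symm
  have hbij : Function.Bijective f := Finite.injective_iff_bijective.1 hinj
  have h1 : {i | Set.ncard {j | r j i} < k} = f ⁻¹' {m : Fin n | (m : ℕ) < k} := rfl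
  rw [h1, Set.ncard_preimage_of_injective_subset_range hinj (by simp [hbij.2.range_eq])]
  have h2 : {m : Fin n | (m : ℕ) < k} = Set.range (Fin.castLE hk) := by
    ext m
    simp only [mem_ofPred_eq, mem_range]
    constructor
    · intro hm; exact ⟨⟨m, hm⟩, rfl⟩
    · rintro ⟨a, rfl⟩; simp
  rw [h2, ← Set.image_univ, Set.ncard_image_of_injective _ (Fin.castLE_injective hk)]
  simp

theorem Lab_flip {n k : ℕ} (hk : k ≤ n) (hodd : Odd k) (s : Fin n → ℝ × Bool)
    (π : Equiv.Perm (Fin n)) :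
    Lab n k (fun i => ((s i).1, !(s i).2)) π = !Lab n k s π := by
  set S : Set (Fin n) := {i | Set.ncard {j | (s j).1 < (s i).1 ∨
    ((s j).1 = (s i).1 ∧ π j < π i)} < k} with hS
  have hcard : S.ncard = k := by
    refine ncard_rank hk (fun j i => (s j).1 < (s i).1 ∨ ((s j).1 = (s i).1 ∧ π j < π i)) ?_ ?_ ?_
    · intro i; simp
    · rintro i j l (h1 | ⟨h1, h1'⟩) (h2 | ⟨h2, h2'⟩)
      · exact Or.inl (h1.trans h2)
      · exact Or.inl (h2 ▸ h1)
      · exact Or.inl (h1 ▸ h2)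
      · exact Or.inr ⟨h1.trans h2, h1'.trans h2'⟩
    · intro i j hij
      rcases lt_trichotomy (s i).1 (s j).1 with h1 | h1 | h1
      · exact Or.inl (Or.inl h1)
      · rcases lt_or_gt_of_ne (π.injective.ne hij) with h2 | h2
        · exact Or.inl (Or.inr ⟨h1, h2⟩)
        · exact Or.inr (Or.inr ⟨h1.symm, h2⟩)
      · exact Or.inr (Or.inl h1)
  have hsplit : Set.ncard {i ∈ S | (s i).2 = true} + Set.ncard {i ∈ S | (!(s i).2) = true} = k := by
    rw [← hcard, ← Set.ncard_union_eq ?_ (Set.toFinite _) (Set.toFinite _)]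
    · congr 1
      ext i
      cases hi : (s i).2 <;> simp [hi]
    · rw [Set.disjoint_left]
      rintro i ⟨_, h1⟩ ⟨_, h2⟩
      simp only [h1] at h2
      simp at h2
  have e1 : Lab n k s π = decide (k ≤ 2 * Set.ncard {i ∈ S | (s i).2 = true}) := rfl
  have e2 : Lab n k (fun i => ((s i).1, !(s i).2)) π =
    decide (k ≤ 2 * Set.ncard {i ∈ S | (!(s i).2) = true}) := rfl
  rw [e1, e2, ← decide_not]
  refine decide_eq_decide.2 ?_
  obtain ⟨c, hc⟩ := hodd
  omega

theorem measurable_Lab (n k : ℕ) (π : Equiv.Perm (Fin n)) :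
    Measurable (fun s : Fin n → ℝ × Bool => Lab n k s π) := by
  let c : (Fin n → ℝ × Bool) → (Fin n → Fin n → Bool × Bool) × (Fin n → Bool) := fun s =>
    (fun j i => (decide ((s j).1 < (s i).1), decide ((s j).1 = (s i).1)), fun i => (s i).2)
  let G : (Fin n → Fin n → Bool × Bool) × (Fin n → Bool) → Bool := fun d =>
    decide (k ≤ 2 * Set.ncard {i ∈ {i | Set.ncard {j | (d.1 j i).1 = true ∨
      ((d.1 j i).2 = true ∧ π j < π i)} < k} | d.2 i = true})
  have hG : Measurable G := measurable_of_finite G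
  have hc : Measurable c := by
    refine Measurable.prodMk ?_ (by fun_prop)
    refine measurable_pi_lambda _ fun j => measurable_pi_lambda _ fun i => ?_
    refine Measurable.prodMk ?_ ?_
    · refine measurable_to_bool ?_
      have : (fun s : Fin n → ℝ × Bool => decide ((s j).1 < (s i).1)) ⁻¹' {true} =
        {s | (s j).1 < (s i).1} := by ext; simp
      rw [this]
      exact measurableSet_lt (by fun_prop) (by fun_prop)
    · refine measurable_to_bool ?_
      have : (fun s : Fin n → ℝ × Bool => decide ((s j).1 = (s i).1)) ⁻¹' {true} =
        {s | (s j).1 = (s i).1} := by ext; simp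
      rw [this]
      exact measurableSet_eq_fun (by fun_prop) (by fun_prop)
  have : (fun s : Fin n → ℝ × Bool => Lab n k s π) = G ∘ c := by
    funext s
    simp [Lab, G, c]
  rw [this]
  exact hG.comp hc

theorem Lab_half {n k : ℕ} (hk : k ≤ n) (hodd : Odd k) (π : Equiv.Perm (Fin n))
    (ρ : Measure (ℝ × Bool)) [IsProbabilityMeasure ρ]
    (hρ : MeasurePreserving (fun p : ℝ × Bool => (p.1, !p.2)) ρ ρ) (b : Bool) :
    (Measure.pi fun _ : Fin n => ρ) {s | Lab n k s π ≠ b} = 2⁻¹ := by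
  have hm : ∀ b, MeasurableSet {s : Fin n → ℝ × Bool | Lab n k s π = b} := fun b =>
    measurable_Lab n k π (measurableSet_singleton b)
  have hpi := measurePreserving_pi (fun _ : Fin n => ρ) (fun _ : Fin n => ρ) (fun _ => hρ)
  have h1 : (Measure.pi fun _ : Fin n => ρ) {s | Lab n k s π = true} =
      (Measure.pi fun _ : Fin n => ρ) {s | Lab n k s π = false} := by
    rw [← hpi.measure_preimage (hm true).nullMeasurableSet]
    congr 1
    ext s
    have := Lab_flip hk hodd s π
    simp only [mem_preimage, mem_ofPred_eq]
    rw [this]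
    simp
  have h2 : (Measure.pi fun _ : Fin n => ρ) {s | Lab n k s π = true} +
      (Measure.pi fun _ : Fin n => ρ) {s | Lab n k s π = false} = 1 := by
    have h3 : {s : Fin n → ℝ × Bool | Lab n k s π = false} = {s | Lab n k s π = true}ᶜ := by
      ext s; simp
    rw [h3, measure_add_measure_compl (hm true), measure_univ]
  have h4 : ∀ x : ℝ≥0∞, x + x = 1 → x = 2⁻¹ := by
    intro x hx
    rw [← two_mul, mul_comm] at hx
    exact ENNReal.eq_inv_of_mul_eq_one_left hx
  have h5 : {s : Fin n → ℝ × Bool | Lab n k s π ≠ b} = {s | Lab n k s π = !b} := by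
    ext s; cases b <;> simp
  rw [h5]
  cases b
  · exact h4 _ (by rw [← h1] at h2; exact h2)
  · exact h4 _ (by rw [h1] at h2; exact h2)

section

variable {Ω : Type u} [MetricSpace Ω] [MeasurableSpace Ω] [BorelSpace Ω] {K : Type u}
  [MeasurableSpace K]

/-- The learning problem. -/
def muT (μ1 μ0 : Measure K) (ι : K → Ω) : Measure (Ω × Bool) :=
  μ1.map (fun a => (ι a, true)) + μ0.map (fun a => (ι a, false))

theorem map_dist_eq (hK : ∀ s : Set K, MeasurableSet s) (μ1 μ0 : Measure K) [IsFiniteMeasure μ1]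
    (h : μ1 Set.univ = μ0 Set.univ) (d : K → ℝ)
    (hd : ∀ q : ℚ, μ1 {a | d a ≤ q} = μ0 {a | d a ≤ q}) : μ1.map d = μ0.map d := by
  have hdm : Measurable d := fun s _ => hK _
  refine ext_of_generate_finite _ (BorelSpace.measurable_eq.trans Real.borel_eq_generateFrom_Iic_rat) Real.isPiSystem_Iic_rat ?_ ?_
  · intro s hs
    obtain ⟨q, rfl⟩ := mem_iUnion.1 hs
    rw [Measure.map_apply hdm measurableSet_Iic, Measure.map_apply hdm measurableSet_Iic]
    exact hd q
  · rw [Measure.map_apply hdm MeasurableSet.univ, Measure.map_apply hdm MeasurableSet.univ]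
    exact h

theorem muT_isProb (hK : ∀ s : Set K, MeasurableSet s) (μ1 μ0 : Measure K)
    (h1 : μ1 Set.univ = 2⁻¹) (h0 : μ0 Set.univ = 2⁻¹) (ι : K → Ω) :
    IsProbabilityMeasure (muT μ1 μ0 ι) := by
  constructor
  have hm : ∀ b : Bool, Measurable (fun a => (ι a, b)) := fun b s _ => hK _
  rw [muT, Measure.add_apply, Measure.map_apply (hm _) MeasurableSet.univ,
    Measure.map_apply (hm _) MeasurableSet.univ]
  simp only [preimage_univ, h1, h0, ENNReal.inv_two_add_inv_two]

theorem muT_flip (hK : ∀ s : Set K, MeasurableSet s) (μ1 μ0 : Measure K) [IsFiniteMeasure μ1]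
    (h : μ1 Set.univ = μ0 Set.univ) (ι : K → Ω) (x : Ω)
    (hd : ∀ q : ℚ, μ1 {a | dist x (ι a) ≤ q} = μ0 {a | dist x (ι a) ≤ q}) :
    MeasurePreserving (fun p : ℝ × Bool => (p.1, !p.2))
      ((muT μ1 μ0 ι).map (fun p => (dist x p.1, p.2)))
      ((muT μ1 μ0 ι).map (fun p => (dist x p.1, p.2))) := by
  have hflip : Measurable (fun p : ℝ × Bool => (p.1, !p.2)) :=
    measurable_fst.prodMk ((measurable_of_finite not).comp measurable_snd)
  have hx : Measurable (fun p : Ω × Bool => (dist x p.1, p.2)) :=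
    ((continuous_const.dist continuous_id).measurable.comp measurable_fst).prodMk measurable_snd
  have hm : ∀ b : Bool, Measurable (fun a => (ι a, b)) := fun b s _ => hK _
  have hdm : Measurable (fun a => dist x (ι a)) := fun s _ => hK _
  have hb : ∀ b : Bool, Measurable (fun r : ℝ => (r, b)) := fun b => by fun_prop
  have heq := map_dist_eq hK μ1 μ0 h (fun a => dist x (ι a)) hd
  have e : (muT μ1 μ0 ι).map (fun p => (dist x p.1, p.2)) =
      (μ1.map (fun a => dist x (ι a))).map (fun r => (r, true)) +
      (μ1.map (fun a => dist x (ι a))).map (fun r => (r, false)) := by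
    rw [muT, Measure.map_add _ _ hx, Measure.map_map hx (hm _), Measure.map_map hx (hm _),
      Measure.map_map (hb _) hdm]
    conv_rhs => rw [heq]
    rw [Measure.map_map (hb _) hdm]
    rfl
  refine ⟨hflip, ?_⟩
  rw [e, Measure.map_add _ _ hflip, Measure.map_map hflip (hb _), Measure.map_map hflip (hb _),
    add_comm]
  rfl

theorem error_ge (hK : ∀ s : Set K, MeasurableSet s) (μ1 μ0 : Measure K)
    (h1 : μ1 Set.univ = 2⁻¹) (h0 : μ0 Set.univ = 2⁻¹) (ι : K → Ω)
    (hd : ∀ x : K, ∀ q : ℚ, μ1 {a | dist (ι x) (ι a) ≤ q} = μ0 {a | dist (ι x) (ι a) ≤ q})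
    {n k : ℕ} (hk : k ≤ n) (hodd : Odd k) : 2⁻¹ ≤ kNNError (muT μ1 μ0 ι) n k := by
  have hP := muT_isProb hK μ1 μ0 h1 h0 ι
  have hf : IsFiniteMeasure μ1 := ⟨by rw [h1]; simp⟩
  have hm : ∀ b : Bool, Measurable (fun a => (ι a, b)) := fun b s _ => hK _
  have key : ∀ π : Equiv.Perm (Fin n), 2⁻¹ ≤
      (Measure.pi fun _ : Fin n => muT μ1 μ0 ι).prod (muT μ1 μ0 ι)
        {q : (Fin n → Ω × Bool) × (Ω × Bool) | kNNLabel n k q.1 π q.2.1 ≠ q.2.2} := by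
    intro π
    rw [← measure_toMeasurable]
    set Q := toMeasurable ((Measure.pi fun _ : Fin n => muT μ1 μ0 ι).prod (muT μ1 μ0 ι))
        {q : (Fin n → Ω × Bool) × (Ω × Bool) | kNNLabel n k q.1 π q.2.1 ≠ q.2.2} with hQ
    have hQm : MeasurableSet Q := measurableSet_toMeasurable _ _
    have hF := measurable_measure_prodMk_right
      (μ := Measure.pi fun _ : Fin n => muT μ1 μ0 ι) hQm
    have hlow : ∀ a : K, ∀ b : Bool, 2⁻¹ ≤ (Measure.pi fun _ : Fin n => muT μ1 μ0 ι)
        ((fun s => (s, (ι a, b))) ⁻¹' Q) := by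
      intro a b
      have hx : Measurable (fun p : Ω × Bool => (dist (ι a) p.1, p.2)) :=
        ((continuous_const.dist continuous_id).measurable.comp measurable_fst).prodMk
          measurable_snd
      have hfl := muT_flip hK μ1 μ0 (h1.trans h0.symm) ι (ι a) (hd a)
      have hρ : IsProbabilityMeasure ((muT μ1 μ0 ι).map (fun p => (dist (ι a) p.1, p.2))) :=
        Measure.isProbabilityMeasure_map hx.aemeasurable
      have hL := Lab_half hk hodd π _ hfl b
      have hmp := measurePreserving_pi (fun _ : Fin n => muT μ1 μ0 ι)
        (fun _ : Fin n => (muT μ1 μ0 ι).map (fun p => (dist (ι a) p.1, p.2)))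
        (fun _ => ⟨hx, rfl⟩)
      have hms : MeasurableSet {s : Fin n → ℝ × Bool | Lab n k s π ≠ b} :=
        measurable_Lab n k π (measurableSet_singleton b).compl
      rw [← hL, ← hmp.measure_preimage hms.nullMeasurableSet]
      refine measure_mono ?_
      intro s hs
      exact subset_toMeasurable _ _ hs
    rw [Measure.prod_apply_symm hQm]
    have hsplit : ∀ F : Ω × Bool → ℝ≥0∞, ∫⁻ y, F y ∂(muT μ1 μ0 ι) =
        ∫⁻ y, F y ∂(μ1.map (fun a => (ι a, true))) +
          ∫⁻ y, F y ∂(μ0.map (fun a => (ι a, false))) := fun F => lintegral_add_measure _ _ _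
    rw [hsplit, lintegral_map hF (hm _), lintegral_map hF (hm _)]
    have g1 : (2⁻¹ : ℝ≥0∞) * 2⁻¹ ≤ ∫⁻ a, (Measure.pi fun _ : Fin n => muT μ1 μ0 ι)
        ((fun s => (s, (ι a, true))) ⁻¹' Q) ∂μ1 := by
      calc (2⁻¹ : ℝ≥0∞) * 2⁻¹ = ∫⁻ _ : K, 2⁻¹ ∂μ1 := by rw [lintegral_const, h1]
        _ ≤ _ := lintegral_mono fun a => hlow a true
    have g0 : (2⁻¹ : ℝ≥0∞) * 2⁻¹ ≤ ∫⁻ a, (Measure.pi fun _ : Fin n => muT μ1 μ0 ι)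
        ((fun s => (s, (ι a, false))) ⁻¹' Q) ∂μ0 := by
      calc (2⁻¹ : ℝ≥0∞) * 2⁻¹ = ∫⁻ _ : K, 2⁻¹ ∂μ0 := by rw [lintegral_const, h0]
        _ ≤ _ := lintegral_mono fun a => hlow a false
    refine le_trans (le_of_eq ?_) (add_le_add g1 g0)
    rw [← mul_add, ENNReal.inv_two_add_inv_two, mul_one]
  rw [kNNError, ENNReal.le_div_iff_mul_le (Or.inl (by simp [Nat.factorial_ne_zero]))
    (Or.inl (by simp))]
  calc (2⁻¹ : ℝ≥0∞) * (Nat.factorial n : ℝ≥0∞)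
      = ∑ _π : Equiv.Perm (Fin n), 2⁻¹ := by
        simp [Fintype.card_perm, mul_comm]
    _ ≤ _ := Finset.sum_le_sum fun π _ => key π

theorem bayes_lt (hK : ∀ s : Set K, MeasurableSet s) (μ1 μ0 : Measure K)
    (h1 : μ1 Set.univ = 2⁻¹) (h0 : μ0 Set.univ = 2⁻¹) (ι : K → Ω) (hι : Function.Injective ι)
    (hcl : ∀ s : Set K, IsClosed (ι '' s)) (B : Set K) (hB : μ1 B ≠ μ0 B) :
    bayesError (muT μ1 μ0 ι) < 2⁻¹ := by
  have hf1 : IsFiniteMeasure μ1 := ⟨by rw [h1]; simp⟩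
  have hf0 : IsFiniteMeasure μ0 := ⟨by rw [h0]; simp⟩
  have hc1 := measure_add_measure_compl (μ := μ1) (hK B)
  have hc0 := measure_add_measure_compl (μ := μ0) (hK B)
  rw [h1] at hc1
  rw [h0] at hc0
  obtain ⟨C, hC⟩ : ∃ C, μ0 C < μ1 C := by
    rcases lt_or_gt_of_ne hB with hlt | hlt
    · refine ⟨Bᶜ, ?_⟩
      by_contra! hge
      have := ENNReal.add_lt_add_of_lt_of_le (measure_ne_top _ _) hlt hge
      rw [hc1, hc0] at this
      exact lt_irrefl _ this
    · exact ⟨B, hlt⟩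
  classical
  let T : Ω → Bool := fun x => decide (x ∈ ι '' C)
  have hT : Measurable T := by
    refine measurable_to_bool ?_
    have : T ⁻¹' {true} = ι '' C := by ext; simp [T]
    rw [this]
    exact (hcl C).measurableSet
  have hm : ∀ b : Bool, Measurable (fun a => (ι a, b)) := fun b s _ => hK _
  have hset : MeasurableSet {p : Ω × Bool | T p.1 ≠ p.2} :=
    (measurableSet_eq_fun (hT.comp measurable_fst) measurable_snd).compl
  refine lt_of_le_of_lt (iInf₂_le T hT) ?_
  rw [muT, Measure.add_apply, Measure.map_apply (hm _) hset, Measure.map_apply (hm _) hset]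
  have e1 : (fun a => (ι a, true)) ⁻¹' {p : Ω × Bool | T p.1 ≠ p.2} = Cᶜ := by
    ext a; simp [T, hι.eq_iff]
  have e0 : (fun a => (ι a, false)) ⁻¹' {p : Ω × Bool | T p.1 ≠ p.2} = C := by
    ext a; simp [T, hι.eq_iff]
  rw [e1, e0]
  have := measure_add_measure_compl (μ := μ1) (hK C)
  rw [h1] at this
  rw [← this, add_comm]
  exact ENNReal.add_lt_add_right (measure_ne_top _ _) hC

end

theorem ksq_tendsto : Tendsto (fun n : ℕ => 2 * Nat.sqrt n + 1) atTop atTop := by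
  refine tendsto_atTop.2 fun b => ?_
  filter_upwards [eventually_ge_atTop (b * b)] with n hn
  have := Nat.le_sqrt.2 hn
  omega

theorem ksq_le : ∀ᶠ n : ℕ in atTop, 2 * Nat.sqrt n + 1 ≤ n := by
  filter_upwards [eventually_ge_atTop 9] with n hn
  have h1 : 3 ≤ Nat.sqrt n := Nat.le_sqrt.2 hn
  have h2 := Nat.sqrt_le n
  nlinarith

theorem ksq_div : Tendsto (fun n : ℕ => ((2 * Nat.sqrt n + 1 : ℕ) : ℝ) / n) atTop (nhds 0) := by
  have hs : Tendsto (fun n : ℕ => (Nat.sqrt n : ℝ)) atTop atTop := by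
    refine tendsto_natCast_atTop_atTop.comp (tendsto_atTop.2 fun b => ?_)
    filter_upwards [eventually_ge_atTop (b * b)] with n hn
    exact Nat.le_sqrt.2 hn
  have hlim : Tendsto (fun n : ℕ => 3 / (Nat.sqrt n : ℝ)) atTop (nhds 0) :=
    tendsto_const_nhds.div_atTop hs
  refine tendsto_of_tendsto_of_tendsto_of_le_of_le' tendsto_const_nhds hlim
    (Eventually.of_forall fun n => by positivity) ?_
  filter_upwards [eventually_ge_atTop 1] with n hn
  have h1 : 1 ≤ Nat.sqrt n := Nat.le_sqrt.2 hn
  have h2 := Nat.sqrt_le n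
  have h1' : (1 : ℝ) ≤ (Nat.sqrt n : ℝ) := by exact_mod_cast h1
  have h2' : (Nat.sqrt n : ℝ) * Nat.sqrt n ≤ n := by exact_mod_cast h2
  have hn' : (0 : ℝ) < n := by exact_mod_cast hn
  rw [div_le_div_iff₀ hn' (by linarith)]
  push_cast
  nlinarith

end KNNAux

/-- **Corollary.** Let `Ω` be a metric space whose density is greater than or equal to
some atomlessly measurable cardinal.  Then the `k`-nearest neighbour learning rule in
`Ω` is not universally consistent. -/
theorem kNN_not_universallyConsistent_of_atomlesslyMeasurable_le_density
    (Ω : Type u) [MetricSpace Ω] (τ : Cardinal.{u})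
    (hτ : IsAtomlesslyMeasurableCardinal τ) (hd : τ ≤ densityCard Ω) :
    ¬ kNNUniversallyConsistent Ω := by
  obtain ⟨K, mK, lo, μ, hcard, h, hP, hat⟩ := KNNAux.exists_rvm τ hτ
  rw [← hcard] at hd
  obtain ⟨ε, hε, ι, hι⟩ := h.exists_sep hd
  have hK0 : ℵ₀ ≤ #K := h.aleph0_lt.le
  have hKQ : #(K × ℚ) = #K := by
    rw [Cardinal.mk_prod]
    simp [Cardinal.mul_eq_left hK0 hK0 Cardinal.aleph0_ne_zero]
  obtain ⟨e⟩ := Cardinal.eq.1 hKQ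
  obtain ⟨μ1, μ0, h1, h0, hA, B, hB⟩ := h.two_measures hat
    (fun i => {a | dist (ι (e.symm i).1) (ι a) ≤ (e.symm i).2})
  have hd2 : ∀ x : K, ∀ q : ℚ,
      μ1 {a | dist (ι x) (ι a) ≤ q} = μ0 {a | dist (ι x) (ι a) ≤ q} := by
    intro x q
    have := hA (e (x, q))
    simpa using this
  have hinj : Function.Injective ι := by
    intro x y hxy
    by_contra hne
    have := hι x y hne
    rw [hxy, dist_self] at this
    linarith
  intro hcons
  let mΩ : MeasurableSpace Ω := borel Ω
  have hbor : BorelSpace Ω := ⟨rfl⟩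
  have hlim := hcons (fun n => 2 * Nat.sqrt n + 1) KNNAux.ksq_tendsto KNNAux.ksq_div
    (KNNAux.muT μ1 μ0 ι) (KNNAux.muT_isProb h.meas μ1 μ0 h1 h0 ι)
  have hlt := KNNAux.bayes_lt h.meas μ1 μ0 h1 h0 ι hinj
    (KNNAux.isClosed_image_of_sep hε hι) B hB
  refine absurd (ge_of_tendsto hlim (b := 2⁻¹) ?_) (not_le.2 hlt)
  filter_upwards [KNNAux.ksq_le] with n hn
  exact KNNAux.error_ge h.meas μ1 μ0 h1 h0 ι hd2 hn ⟨Nat.sqrt n, rfl⟩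

end
end

section
/- Let Ω be a metric space whose metric takes only the two values 0 and r for some r > 0. The k-nearest neighbour classifier in Ω, with distance ties broken by a uniformly random ordering of the sample, is universally consistent if and only if the cardinality of Ω is strictly less than every real-valued measurable cardinal. -/
open MeasureTheory Filter Set Metric Cardinal
open scoped ENNReal

noncomputable section

universe u

lemma aux_prod_markov {α : Type*} [MeasurableSpace α] (μ : Measure α) [IsProbabilityMeasure μ]
    (g : α → ℝ≥0∞) (hg : Measurable g) {n : ℕ} (I : Finset (Fin n)) (c : ℝ≥0∞) :
    c * Measure.pi (fun _ : Fin n => μ) {σ | c ≤ ∏ i ∈ I, g (σ i)} ≤ (∫⁻ y, g y ∂μ) ^ I.card := by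
  have hind : ProbabilityTheory.iIndepFun (fun (i : Fin n) (σ : Fin n → α) => g (σ i))
      (Measure.pi (fun _ : Fin n => μ)) :=
    ProbabilityTheory.iIndepFun_pi (X := fun _ => g) (fun i => hg.aemeasurable)
  have hm : ∀ i : Fin n, Measurable (fun σ : Fin n → α => g (σ i)) :=
    fun i => hg.comp (measurable_pi_apply i)
  refine (mul_meas_ge_le_lintegral (Finset.measurable_fun_prod _ fun i _ => hm i) c).trans ?_
  rw [ProbabilityTheory.lintegral_prod_eq_prod_lintegral_of_indepFun I _ hind hm]
  rw [Finset.prod_congr rfl (g := fun _ => ∫⁻ y, g y ∂μ), Finset.prod_const]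
  intro i _
  exact (measurePreserving_eval (fun _ : Fin n => μ) i).lintegral_comp hg

open Classical in
lemma aux_chernoff {α : Type*} [MeasurableSpace α] (μ : Measure α) [IsProbabilityMeasure μ]
    (B B' : Set α) (hB : MeasurableSet B) (hB' : MeasurableSet B') (hd : Disjoint B B')
    (hlt : μ B' < μ B) :
    ∃ ρ : ℝ≥0∞, ρ < 1 ∧ ∀ (n : ℕ) (I : Finset (Fin n)),
      Measure.pi (fun _ : Fin n => μ)
        {σ | (I.filter fun i => σ i ∈ B).card ≤ (I.filter fun i => σ i ∈ B').card}
        ≤ ρ ^ I.card := by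
  obtain ⟨p, hp0, hp⟩ : ∃ p : ℝ, 0 ≤ p ∧ μ B = ENNReal.ofReal p :=
    ⟨(μ B).toReal, ENNReal.toReal_nonneg, (ENNReal.ofReal_toReal (measure_ne_top _ _)).symm⟩
  obtain ⟨q, hq0, hq⟩ : ∃ p : ℝ, 0 ≤ p ∧ μ B' = ENNReal.ofReal p :=
    ⟨(μ B').toReal, ENNReal.toReal_nonneg, (ENNReal.ofReal_toReal (measure_ne_top _ _)).symm⟩
  have hpq : q < p := by
    rw [hp, hq] at hlt
    exact (ENNReal.ofReal_lt_ofReal_iff_of_nonneg hq0).1 hlt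
  have hrest : μ (B ∪ B')ᶜ = ENNReal.ofReal (1 - p - q) := by
    rw [prob_compl_eq_one_sub (hB.union hB'), measure_union hd hB', hp, hq,
      ← ENNReal.ofReal_add hp0 hq0, ← ENNReal.ofReal_one, ← ENNReal.ofReal_sub _ (by positivity)]
    congr 1; ring
  have hsum : p + q ≤ 1 := by
    have : μ (B ∪ B') ≤ 1 := prob_le_one
    rw [measure_union hd hB', hp, hq, ← ENNReal.ofReal_add hp0 hq0] at this
    exact ENNReal.ofReal_le_one.1 this
  set z : ℝ := 2 * p / (p + q) with hz
  have hpp : 0 < p := by linarith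
  have hz1 : 1 < z := by rw [hz, lt_div_iff₀ (by linarith)]; linarith
  set a : ℝ≥0∞ := ENNReal.ofReal (1 / z)
  set b : ℝ≥0∞ := ENNReal.ofReal z
  have hab : a * b = 1 := by
    rw [← ENNReal.ofReal_mul (by positivity), one_div, inv_mul_cancel₀ (by positivity),
      ENNReal.ofReal_one]
  have hb1 : 1 ≤ b := by
    rw [← ENNReal.ofReal_one]; exact ENNReal.ofReal_le_ofReal hz1.le
  let g : α → ℝ≥0∞ := fun y => if y ∈ B then a else if y ∈ B' then b else 1
  have hg : Measurable g :=
    Measurable.ite hB measurable_const (Measurable.ite hB' measurable_const measurable_const)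
  refine ⟨∫⁻ y, g y ∂μ, ?_, ?_⟩
  · have hgs : g = fun y => B.indicator (fun _ => a) y + B'.indicator (fun _ => b) y +
        (B ∪ B')ᶜ.indicator (fun _ => 1) y := by
      funext y
      by_cases h1 : y ∈ B
      · have h2 : y ∉ B' := fun h => Set.disjoint_left.1 hd h1 h
        simp [g, h1, h2]
      · by_cases h2 : y ∈ B' <;> simp [g, h1, h2]
    rw [hgs, lintegral_add_right _ (measurable_const.indicator (hB.union hB').compl),
      lintegral_add_right _ (measurable_const.indicator hB'),
      lintegral_indicator_const hB, lintegral_indicator_const hB',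
      lintegral_indicator_const (hB.union hB').compl, hp, hq, hrest, one_mul,
      ← ENNReal.ofReal_mul (by positivity), ← ENNReal.ofReal_mul (by positivity),
      ← ENNReal.ofReal_add (by positivity) (by positivity),
      ← ENNReal.ofReal_add (by positivity) (by linarith), ENNReal.ofReal_lt_one]
    have h1 : 1 / z * p = (p + q) / 2 := by rw [hz]; field_simp
    have h2 : z * q = 2 * p * q / (p + q) := by rw [hz]; field_simp
    have h3 : 2 * p * q / (p + q) < (p + q) / 2 := by
      rw [div_lt_div_iff₀ (by linarith) (by norm_num)]
      nlinarith [sq_pos_of_pos (sub_pos.2 hpq)]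
    rw [h1, h2]; linarith
  · intro n I
    refine le_trans ?_ (le_trans (aux_prod_markov μ g hg I 1).ge.le le_rfl)
    rw [one_mul]
    apply measure_mono
    intro σ hσ
    simp only [Set.mem_ofPred_eq] at hσ ⊢
    have : ∏ i ∈ I, g (σ i) = a ^ (I.filter fun i => σ i ∈ B).card *
        b ^ (I.filter fun i => σ i ∈ B').card := by
      simp only [g]
      rw [Finset.prod_ite, Finset.prod_const, Finset.prod_ite, Finset.prod_const,
        Finset.prod_const_one, mul_one]
      congr 2
      rw [Finset.filter_filter]
      congr 1
      ext i
      simp only [Finset.mem_filter]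
      exact ⟨fun h => ⟨h.1, h.2.2⟩, fun h => ⟨h.1, fun h' => Set.disjoint_left.1 hd h' h.2, h.2⟩⟩
    rw [this]
    obtain ⟨d, hd'⟩ := Nat.exists_eq_add_of_le hσ
    rw [hd', pow_add, ← mul_assoc, ← mul_pow, hab, one_pow, one_mul]
    exact one_le_pow₀ hb1

open Classical in
lemma aux_few_hits {α : Type*} [MeasurableSpace α] (μ : Measure α) [IsProbabilityMeasure μ]
    (A : Set α) (hA : MeasurableSet A) (n k : ℕ) :
    Measure.pi (fun _ : Fin n => μ)
        {σ | (Finset.univ.filter fun i => σ i ∈ A).card < k}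
      ≤ ENNReal.ofReal (2 ^ k * (1 - μ.real A / 2) ^ n) := by
  let g : α → ℝ≥0∞ := fun y => if y ∈ A then 2⁻¹ else 1
  have hg : Measurable g := Measurable.ite hA measurable_const measurable_const
  have hle : μ.real A ≤ 1 := measureReal_le_one
  have hge : 0 ≤ μ.real A := measureReal_nonneg
  have hint : ∫⁻ y, g y ∂μ = ENNReal.ofReal (1 - μ.real A / 2) := by
    have hgs : g = fun y => A.indicator (fun _ => 2⁻¹) y + Aᶜ.indicator (fun _ => 1) y := by
      funext y
      by_cases h1 : y ∈ A <;> simp [g, h1]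
    have h2 : (2⁻¹ : ℝ≥0∞) = ENNReal.ofReal (1/2) := by
      rw [one_div, ENNReal.ofReal_inv_of_pos (by norm_num)]; simp
    rw [hgs, lintegral_add_right _ (measurable_const.indicator hA.compl),
      lintegral_indicator_const hA, lintegral_indicator_const hA.compl, one_mul,
      ← ofReal_measureReal (μ := μ) (s := A), ← ofReal_measureReal (μ := μ) (s := Aᶜ),
      probReal_compl_eq_one_sub hA, h2, ← ENNReal.ofReal_mul (by positivity),
      ← ENNReal.ofReal_add (by positivity) (by linarith)]
    congr 1; ring
  have key := aux_prod_markov μ g hg (Finset.univ : Finset (Fin n)) (2⁻¹ ^ k)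
  rw [hint, Finset.card_univ, Fintype.card_fin] at key
  have hsub : {σ : Fin n → α | (Finset.univ.filter fun i => σ i ∈ A).card < k} ⊆
      {σ | 2⁻¹ ^ k ≤ ∏ i, g (σ i)} := by
    intro σ hσ
    simp only [Set.mem_ofPred_eq] at hσ ⊢
    simp only [g]
    rw [Finset.prod_ite, Finset.prod_const, Finset.prod_const_one, mul_one]
    exact pow_le_pow_right_of_le_one' (by simp) hσ.le
  have h2 : (2 : ℝ≥0∞) ^ k * 2⁻¹ ^ k = 1 := by
    rw [← mul_pow, ENNReal.mul_inv_cancel (by simp) (by simp), one_pow]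
  calc _ ≤ Measure.pi (fun _ : Fin n => μ) {σ | 2⁻¹ ^ k ≤ ∏ i, g (σ i)} := measure_mono hsub
    _ = 2 ^ k * (2⁻¹ ^ k * Measure.pi (fun _ : Fin n => μ) {σ | 2⁻¹ ^ k ≤ ∏ i, g (σ i)}) := by
        rw [← mul_assoc, h2, one_mul]
    _ ≤ 2 ^ k * ENNReal.ofReal (1 - μ.real A / 2) ^ n := by gcongr
    _ = _ := by
        rw [ENNReal.ofReal_mul (by positivity), ENNReal.ofReal_pow (by norm_num),
          ENNReal.ofReal_pow (by linarith)]
        simp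

lemma aux_few_hits_tendsto (k : ℕ → ℕ)
    (hk : Tendsto (fun n : ℕ => (k n : ℝ) / n) atTop (nhds 0)) (q : ℝ) (hq0 : 0 < q) (hq1 : q < 1) :
    Tendsto (fun n : ℕ => ENNReal.ofReal (2 ^ (k n) * q ^ n)) atTop (nhds 0) := by
  rw [← ENNReal.ofReal_zero]
  apply ENNReal.tendsto_ofReal
  have h1 : Tendsto (fun n : ℕ => (n : ℝ) * ((k n : ℝ) / n * Real.log 2 + Real.log q)) atTop atBot := by
    apply Tendsto.atTop_mul_neg (C := 0 * Real.log 2 + Real.log q)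
    · simpa using Real.log_neg hq0 hq1
    · exact tendsto_natCast_atTop_atTop
    · exact (hk.mul_const _).add_const _
  refine (Real.tendsto_exp_atBot.comp h1).congr' ?_
  filter_upwards [eventually_gt_atTop 0] with n hn
  have hn' : (n : ℝ) ≠ 0 := by positivity
  have : (n : ℝ) * ((k n : ℝ) / n * Real.log 2 + Real.log q) = k n * Real.log 2 + n * Real.log q := by
    field_simp
  simp only [Function.comp]
  rw [this, Real.exp_add, Real.exp_nat_mul, Real.exp_nat_mul, Real.exp_log (by norm_num), Real.exp_log hq0]

open Classical in
lemma aux_exists_level {n k : ℕ} (π : Equiv.Perm (Fin n)) (A : Finset (Fin n)) (hA : k ≤ A.card) :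
    ∃ m, k ≤ m ∧ m ≤ n ∧ (A.filter fun i => (π i : ℕ) < m).card = k := by
  let c : ℕ → ℕ := fun m => (A.filter fun i => (π i : ℕ) < m).card
  have hcn : k ≤ c n := by
    have : (A.filter fun i => (π i : ℕ) < n) = A := by
      ext i; simp
    simpa [c, this] using hA
  have hex : ∃ m, k ≤ c m := ⟨n, hcn⟩
  have hle : ∀ m, c m ≤ m := by
    intro m
    have : c m ≤ (Finset.range m).card := by
      apply Finset.card_le_card_of_injOn (fun i => (π i : ℕ))
      · intro i hi
        simp at hi ⊢
        exact hi.2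
      · intro i _ j _ h
        exact π.injective (Fin.ext h)
    simpa using this
  have hstep : ∀ m, c (m + 1) ≤ c m + 1 := by
    intro m
    by_cases hm : m < n
    · have : (A.filter fun i => (π i : ℕ) < m + 1) ⊆
          insert (π.symm ⟨m, hm⟩) (A.filter fun i => (π i : ℕ) < m) := by
        intro i hi
        simp only [Finset.mem_filter, Finset.mem_insert] at hi ⊢
        rcases Nat.lt_succ_iff_lt_or_eq.1 hi.2 with h | h
        · exact Or.inr ⟨hi.1, h⟩
        · left
          rw [Equiv.eq_symm_apply]
          exact Fin.ext h
      exact (Finset.card_le_card this).trans (Finset.card_insert_le _ _)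
    · have : (A.filter fun i => (π i : ℕ) < m + 1) ⊆ (A.filter fun i => (π i : ℕ) < m) := by
        intro i hi
        simp only [Finset.mem_filter] at hi ⊢
        exact ⟨hi.1, by have := (π i).2; omega⟩
      exact (Finset.card_le_card this).trans (Nat.le_succ _)
  have hspec : k ≤ c (Nat.find hex) := Nat.find_spec hex
  refine ⟨Nat.find hex, hspec.trans (hle _), Nat.find_le hcn, ?_⟩
  change c (Nat.find hex) = k
  apply le_antisymm _ hspec
  rcases h : Nat.find hex with _ | m
  · exact (hle 0).trans (Nat.zero_le _)
  · have h1 : c m < k := not_le.1 (Nat.find_min hex (by omega))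
    have := hstep m
    omega

/-- If the samples with index in `A` are at distance `d` and all others farther, the
`k` nearest neighbours are the first `k` ones of `A`. -/
lemma aux_neighbours {Ω : Type u} [MetricSpace Ω] {n k : ℕ} (σ : Fin n → Ω × Bool)
    (π : Equiv.Perm (Fin n)) (x : Ω) (d : ℝ) (A : Finset (Fin n))
    (hAd : ∀ i ∈ A, dist x (σ i).1 = d) (hAd' : ∀ i ∉ A, d < dist x (σ i).1)
    (m : ℕ) (hm : (A.filter fun i => (π i : ℕ) < m).card = k) :
    kNNLabel n k σ π x =
      decide (k ≤ 2 * ((A.filter fun i => (π i : ℕ) < m).filter fun i => (σ i).2 = true).card) := by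
  have hS : ∀ i : Fin n, (Set.ncard {j : Fin n | dist x (σ j).1 < dist x (σ i).1 ∨
      (dist x (σ j).1 = dist x (σ i).1 ∧ π j < π i)} < k) ↔ i ∈ (A.filter fun i => (π i : ℕ) < m) := by
    intro i
    constructor
    · intro h
      by_contra hi
      have hsub : ((A.filter fun i => (π i : ℕ) < m : Finset (Fin n)) : Set (Fin n)) ⊆
          {j : Fin n | dist x (σ j).1 < dist x (σ i).1 ∨
            (dist x (σ j).1 = dist x (σ i).1 ∧ π j < π i)} := by
        intro j hj
        simp only [Finset.coe_filter, Set.mem_ofPred_eq] at hj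
        by_cases hiA : i ∈ A
        · right
          refine ⟨by rw [hAd j hj.1, hAd i hiA], ?_⟩
          have : ¬ (π i : ℕ) < m := fun h' => hi (Finset.mem_filter.2 ⟨hiA, h'⟩)
          rw [Fin.lt_def]; omega
        · left
          rw [hAd j hj.1]; exact hAd' i hiA
      have := Set.ncard_le_ncard hsub (Set.toFinite _)
      rw [Set.ncard_coe_finset, hm] at this
      omega
    · intro hi
      have hi' := Finset.mem_filter.1 hi
      rw [← hm, ← Set.ncard_coe_finset]
      apply Set.ncard_lt_ncard _ (Set.toFinite _)
      refine (Set.ssubset_iff_of_subset ?_).2 ⟨i, hi, ?_⟩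
      · intro j hj
        simp only [Set.mem_ofPred_eq] at hj
        rw [hAd i hi'.1] at hj
        have hjA : j ∈ A := by
          by_contra hjA
          have := hAd' j hjA
          rcases hj with h | h <;> linarith [h]
        have : π j < π i := by
          rcases hj with h | h
          · rw [hAd j hjA] at h; exact absurd h (lt_irrefl _)
          · exact h.2
        simp only [Finset.coe_filter, Set.mem_ofPred_eq]
        exact ⟨hjA, lt_trans (Fin.lt_def.1 this) hi'.2⟩
      · simp
  unfold kNNLabel
  simp only
  congr 3
  rw [← Set.ncard_coe_finset]
  congr 1
  ext i
  simp only [Set.mem_ofPred_eq, Finset.coe_filter, hS i]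

lemma aux_card_lt {n m : ℕ} (π : Equiv.Perm (Fin n)) (hm : m ≤ n) :
    ((Finset.univ : Finset (Fin n)).filter fun i => (π i : ℕ) < m).card = m := by
  have : ((Finset.univ : Finset (Fin n)).filter fun i => (π i : ℕ) < m).map π.toEmbedding =
      Finset.univ.filter fun i : Fin n => (i : ℕ) < m := by
    ext i
    simp only [Finset.mem_map, Finset.mem_filter, Finset.mem_univ, true_and]
    constructor
    · rintro ⟨j, hj, rfl⟩; exact hj
    · intro h; exact ⟨π.symm i, by simpa using h, by simp⟩
  rw [← Finset.card_map π.toEmbedding, this, Fin.card_filter_val_lt, min_eq_right hm]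

lemma aux_label_count {Ω : Type u} {n k : ℕ} (σ : Fin n → Ω × Bool) (J : Finset (Fin n))
    (hJ : J.card = k) (b : Bool)
    (h : decide (k ≤ 2 * (J.filter fun i => (σ i).2 = true).card) ≠ b) :
    (J.filter fun i => (σ i).2 = b).card ≤ (J.filter fun i => (σ i).2 = !b).card := by
  have hs := Finset.card_filter_add_card_filter_not (s := J) (fun i => (σ i).2 = true)
  have : (J.filter fun i => ¬ (σ i).2 = true) = J.filter fun i => (σ i).2 = false := by
    ext i; simp
  rw [this, hJ] at hs
  cases b
  · simp at h ⊢; omega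
  · simp at h ⊢; omega

open Classical in
/-- wrong decision at an atom implies one of the rare events. -/
lemma aux_wrong_subset {Ω : Type u} [MetricSpace Ω] {n k : ℕ} (π : Equiv.Perm (Fin n)) (x : Ω)
    (b : Bool) :
    {σ : Fin n → Ω × Bool | kNNLabel n k σ π x ≠ b} ⊆
      {σ | (Finset.univ.filter fun i => σ i ∈ (({x} : Set Ω) ×ˢ (univ : Set Bool))).card < k} ∪
      ⋃ m ∈ Finset.Icc k n, {σ |
        ((Finset.univ.filter fun i => (π i : ℕ) < m).filter
            fun i => σ i ∈ ({(x, b)} : Set (Ω × Bool))).card ≤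
        ((Finset.univ.filter fun i => (π i : ℕ) < m).filter
            fun i => σ i ∈ ({(x, !b)} : Set (Ω × Bool))).card} := by
  intro σ hσ
  by_cases hk : (Finset.univ.filter fun i => σ i ∈ (({x} : Set Ω) ×ˢ (univ : Set Bool))).card < k
  · exact Or.inl hk
  right
  set A := (Finset.univ.filter fun i => σ i ∈ (({x} : Set Ω) ×ˢ (univ : Set Bool))) with hA
  have hAx : ∀ i, i ∈ A ↔ (σ i).1 = x := by intro i; simp [hA]
  obtain ⟨m, hkm, hmn, hc⟩ := aux_exists_level π A (not_lt.1 hk)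
  simp only [Set.mem_iUnion]
  refine ⟨m, Finset.mem_Icc.2 ⟨hkm, hmn⟩, ?_⟩
  have h1 := aux_neighbours σ π x 0 A (fun i hi => by rw [(hAx i).1 hi, dist_self])
    (fun i hi => dist_pos.2 fun h => hi ((hAx i).2 h.symm)) m hc
  have h2 : kNNLabel n k σ π x ≠ b := hσ
  rw [h1] at h2
  have h3 := aux_label_count σ _ hc b h2
  have h4 : ∀ c : Bool, ((Finset.univ.filter fun i => (π i : ℕ) < m).filter
            fun i => σ i ∈ ({(x, c)} : Set (Ω × Bool))) =
      (A.filter fun i => (π i : ℕ) < m).filter fun i => (σ i).2 = c := by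
    intro c
    ext i
    simp only [Finset.mem_filter, hAx, Set.mem_singleton_iff, Prod.ext_iff, Finset.mem_univ]
    tauto
  simp only [Set.mem_ofPred_eq]
  rw [h4, h4]
  exact h3

lemma aux_wrong_bound {Ω : Type u} [MetricSpace Ω] [MeasurableSpace Ω]
    [MeasurableSingletonClass Ω]
    (μt : Measure (Ω × Bool)) [IsProbabilityMeasure μt] (k : ℕ → ℕ)
    (hk : Tendsto k atTop atTop)
    (hk0 : Tendsto (fun n : ℕ => (k n : ℝ) / n) atTop (nhds 0))
    (x : Ω) (b : Bool) (hlt : μt {(x, !b)} < μt {(x, b)}) :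
    ∃ δ : ℕ → ℝ≥0∞, Tendsto δ atTop (nhds 0) ∧ ∀ n (π : Equiv.Perm (Fin n)),
      Measure.pi (fun _ : Fin n => μt) {σ | kNNLabel n (k n) σ π x ≠ b} ≤ δ n := by
  classical
  obtain ⟨ρ, hρ, hch⟩ := aux_chernoff μt {(x, b)} {(x, !b)} (measurableSet_singleton _)
    (measurableSet_singleton _) (by simp) hlt
  have hAm : MeasurableSet (({x} : Set Ω) ×ˢ (univ : Set Bool)) :=
    (measurableSet_singleton x).prod MeasurableSet.univ
  set q : ℝ := 1 - μt.real (({x} : Set Ω) ×ˢ (univ : Set Bool)) / 2 with hq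
  have hpos : 0 < μt.real (({x} : Set Ω) ×ˢ (univ : Set Bool)) := by
    refine ENNReal.toReal_pos ?_ (measure_ne_top _ _)
    refine ((zero_le.trans_lt hlt).trans_le (measure_mono ?_)).ne'
    simp
  have hle1 : μt.real (({x} : Set Ω) ×ˢ (univ : Set Bool)) ≤ 1 := measureReal_le_one
  refine ⟨fun n => ENNReal.ofReal (2 ^ (k n) * q ^ n) + ρ ^ (k n) * (1 - ρ)⁻¹, ?_, ?_⟩
  · have h1 := aux_few_hits_tendsto k hk0 q (by linarith) (by linarith)
    have h2 : Tendsto (fun n => ρ ^ (k n) * (1 - ρ)⁻¹) atTop (nhds (0 * (1 - ρ)⁻¹)) := by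
      apply ENNReal.Tendsto.mul_const
      · exact (ENNReal.tendsto_pow_atTop_nhds_zero_of_lt_one hρ).comp hk
      · right
        simpa [tsub_eq_zero_iff_le] using hρ
    simpa using h1.add h2
  · intro n π
    refine (measure_mono (aux_wrong_subset π x b)).trans ((measure_union_le _ _).trans ?_)
    refine add_le_add ?_ ?_
    · convert aux_few_hits μt _ hAm n (k n)
      rfl
    · refine (measure_biUnion_finset_le _ _).trans ?_
      calc _ ≤ ∑ m ∈ Finset.Icc (k n) n, ρ ^ m := by
            apply Finset.sum_le_sum
            intro m hm
            have h := hch n (Finset.univ.filter fun i => (π i : ℕ) < m)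
            rw [aux_card_lt π (Finset.mem_Icc.1 hm).2] at h
            convert h
            rfl
        _ = ∑ m ∈ (Finset.Icc (k n) n), ρ ^ (k n) * ρ ^ (m - k n) := by
            apply Finset.sum_congr rfl
            intro m hm
            rw [← pow_add, Nat.add_sub_cancel' (Finset.mem_Icc.1 hm).1]
        _ = ρ ^ (k n) * ∑ m ∈ (Finset.Icc (k n) n).image (fun m => m - k n), ρ ^ m := by
            rw [Finset.mul_sum, Finset.sum_image]
            intro a ha b hb h
            have := (Finset.mem_Icc.1 ha).1
            have := (Finset.mem_Icc.1 hb).1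
            simp only at h
            omega
        _ ≤ ρ ^ (k n) * ∑' m, ρ ^ m := by
            gcongr
            exact ENNReal.sum_le_tsum _
        _ = _ := by rw [ENNReal.tsum_geometric]

lemma aux_discrete {Ω : Type u} [MeasurableSpace Ω] [DiscreteMeasurableSpace Ω] (s : Set (Ω × Bool)) :
    MeasurableSet s := by
  have : s = ((fun x => (x, true)) ⁻¹' s) ×ˢ {true} ∪ ((fun x => (x, false)) ⁻¹' s) ×ˢ {false} := by
    ext ⟨x, b⟩
    cases b <;> simp
  rw [this]
  exact ((MeasurableSet.of_discrete).prod (measurableSet_singleton _)).union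
    ((MeasurableSet.of_discrete).prod (measurableSet_singleton _))

lemma aux_label_measurable {Ω : Type u} [MetricSpace Ω] [MeasurableSpace Ω]
    [DiscreteMeasurableSpace Ω] (r : ℝ)
    (hd : ∀ x y : Ω, dist x y = 0 ∨ dist x y = r) (n k : ℕ) (π : Equiv.Perm (Fin n)) (x : Ω)
    (b : Bool) :
    MeasurableSet {σ : Fin n → Ω × Bool | kNNLabel n k σ π x ≠ b} := by
  classical
  let f : (Fin n → Ω × Bool) → (Fin n → Bool × Bool) := fun σ i => (decide ((σ i).1 = x), (σ i).2)
  have hf : Measurable f := by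
    refine measurable_pi_lambda _ fun i => ?_
    have h0 : Measurable (fun p : Ω × Bool => (decide (p.1 = x), p.2)) := fun s _ => aux_discrete _
    exact h0.comp (measurable_pi_apply i)
  have hsat : {σ : Fin n → Ω × Bool | kNNLabel n k σ π x ≠ b} =
      f ⁻¹' (f '' {σ : Fin n → Ω × Bool | kNNLabel n k σ π x ≠ b}) := by
    apply Set.Subset.antisymm (Set.subset_preimage_image _ _)
    rintro σ ⟨σ', hσ', h⟩
    have h1 : ∀ i, dist x (σ' i).1 = dist x (σ i).1 := by
      intro i
      have hi := congrFun h i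
      simp only [f, Prod.mk.injEq, decide_eq_decide] at hi
      by_cases hx : (σ i).1 = x
      · rw [hi.1.2 hx, hx]
      · have hx' : (σ' i).1 ≠ x := fun h' => hx (hi.1.1 h')
        rw [(hd x (σ i).1).resolve_left fun h' => hx (dist_eq_zero.1 h').symm,
          (hd x (σ' i).1).resolve_left fun h' => hx' (dist_eq_zero.1 h').symm]
    have h2 : ∀ i, (σ' i).2 = (σ i).2 := by
      intro i
      have hi := congrFun h i
      simp only [f, Prod.mk.injEq] at hi
      exact hi.2
    have h3 : kNNLabel n k σ' π x = kNNLabel n k σ π x := by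
      unfold kNNLabel
      simp only [h1, h2]
    simp only [Set.mem_ofPred_eq] at hσ' ⊢
    rwa [← h3]
  rw [hsat]
  exact hf (Set.toFinite _).measurableSet

lemma aux_lower {Ω : Type u} [MeasurableSpace Ω]
    {β : Type*} [MeasurableSpace β] (P : Measure β) [IsProbabilityMeasure P]
    (μt : Measure (Ω × Bool)) [IsProbabilityMeasure μt] (E : Set (β × (Ω × Bool)))
    (f : β → ℝ≥0∞)
    (hf : ∀ s, f s ≤ μt (Prod.mk s ⁻¹' E)) : ∫⁻ s, f s ∂P ≤ P.prod μt E := by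
  rw [← measure_toMeasurable E, Measure.prod_apply (measurableSet_toMeasurable _ _)]
  apply lintegral_mono
  intro s
  exact (hf s).trans (measure_mono (Set.preimage_mono (subset_toMeasurable _ _)))

lemma aux_err_ge {Ω : Type u} [MetricSpace Ω] [MeasurableSpace Ω]
    [DiscreteMeasurableSpace Ω]
    (μt : Measure (Ω × Bool)) [IsProbabilityMeasure μt] (n k : ℕ) :
    bayesError μt ≤ kNNError μt n k := by
  unfold kNNError
  rw [ENNReal.le_div_iff_mul_le (by simp [Nat.factorial_ne_zero]) (by simp)]
  calc bayesError μt * (n.factorial : ℝ≥0∞) = ∑ π : Equiv.Perm (Fin n), bayesError μt := by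
        rw [Finset.sum_const, Finset.card_univ, Fintype.card_perm, Fintype.card_fin, nsmul_eq_mul,
          mul_comm]
    _ ≤ _ := by
        apply Finset.sum_le_sum
        intro π _
        have := aux_lower (Measure.pi fun _ : Fin n => μt) μt
          {q : (Fin n → Ω × Bool) × (Ω × Bool) | kNNLabel n k q.1 π q.2.1 ≠ q.2.2}
          (fun _ => bayesError μt) (fun σ => iInf₂_le (kNNLabel n k σ π) Measurable.of_discrete)
        simpa using this

lemma aux_err_le {Ω : Type u} [MetricSpace Ω] [MeasurableSpace Ω]
    (μt : Measure (Ω × Bool)) [IsProbabilityMeasure μt] (n k : ℕ) (e : ℝ≥0∞)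
    (h : ∀ π : Equiv.Perm (Fin n), (Measure.pi fun _ : Fin n => μt).prod μt
        {q : (Fin n → Ω × Bool) × (Ω × Bool) | kNNLabel n k q.1 π q.2.1 ≠ q.2.2} ≤ e) :
    kNNError μt n k ≤ e := by
  unfold kNNError
  apply ENNReal.div_le_of_le_mul
  calc _ ≤ ∑ π : Equiv.Perm (Fin n), e := Finset.sum_le_sum fun π _ => h π
    _ = _ := by
      rw [Finset.sum_const, Finset.card_univ, Fintype.card_perm, Fintype.card_fin, nsmul_eq_mul,
          mul_comm]

lemma aux_err_ge' {Ω : Type u} [MetricSpace Ω] [MeasurableSpace Ω]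
    (μt : Measure (Ω × Bool)) [IsProbabilityMeasure μt] (n k : ℕ) (e : ℝ≥0∞)
    (h : ∀ π : Equiv.Perm (Fin n), e ≤ (Measure.pi fun _ : Fin n => μt).prod μt
        {q : (Fin n → Ω × Bool) × (Ω × Bool) | kNNLabel n k q.1 π q.2.1 ≠ q.2.2}) :
    e ≤ kNNError μt n k := by
  unfold kNNError
  rw [ENNReal.le_div_iff_mul_le (by simp [Nat.factorial_ne_zero]) (by simp)]
  calc e * (n.factorial : ℝ≥0∞) = ∑ π : Equiv.Perm (Fin n), e := by
        rw [Finset.sum_const, Finset.card_univ, Fintype.card_perm, Fintype.card_fin, nsmul_eq_mul,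
          mul_comm]
    _ ≤ _ := Finset.sum_le_sum fun π _ => h π

/-- A nonzero finite diffuse measure on all subsets of `Ω` yields a real-valued
measurable cardinal below `#Ω`. -/
lemma aux_rvm {Ω : Type u} [MeasurableSpace Ω] [DiscreteMeasurableSpace Ω] (ν : Measure Ω)
    [IsFiniteMeasure ν] (h0 : ν univ ≠ 0) (hs : ∀ x, ν {x} = 0) :
    ∃ τ : Cardinal.{u}, IsRealValuedMeasurableCardinal τ ∧ τ ≤ #Ω := by
  classical
  let K : Set Cardinal.{u} := {κ | ∃ 𝒩 : Set (Set Ω), #𝒩 = κ ∧ (∀ A ∈ 𝒩, ν A = 0) ∧ ν (⋃₀ 𝒩) ≠ 0}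
  have hmem : #(Set.range fun x : Ω => ({x} : Set Ω)) ∈ K := by
    refine ⟨_, rfl, ?_, ?_⟩
    · rintro _ ⟨x, rfl⟩; exact hs x
    · convert h0
      ext x; simp
  have hKne : K.Nonempty := ⟨_, hmem⟩
  obtain ⟨𝒩, hcard, hnull, hU⟩ := csInf_mem hKne
  set κ := sInf K with hκ
  refine ⟨κ, ?_, (csInf_le' hmem).trans Cardinal.mk_range_le⟩
  set U := ⋃₀ 𝒩 with hUdef
  have hNe : Nonempty 𝒩 := by
    by_contra hne
    rw [not_nonempty_iff, Set.isEmpty_coe_sort] at hne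
    apply hU
    simp [hUdef, hne]
  have hch : ∀ x : Ω, ∃ A : 𝒩, x ∈ U → x ∈ A.1 := by
    intro x
    by_cases hx : x ∈ U
    · obtain ⟨A, hA, hxA⟩ := hx
      exact ⟨⟨A, hA⟩, fun _ => hxA⟩
    · exact ⟨Classical.choice hNe, fun h => absurd h hx⟩
  choose f hf using hch
  obtain ⟨e⟩ : Nonempty (𝒩 ≃ κ.out) := by
    rw [← Cardinal.eq, hcard, Cardinal.mk_out]
  let _ : MeasurableSpace κ.out := ⊤
  let F : Ω → κ.out := fun x => e (f x)
  have hF : Measurable F := Measurable.of_discrete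
  have happ : ∀ s : Set κ.out, ((ν U)⁻¹ • (ν.restrict U).map F) s = (ν U)⁻¹ * ν (F ⁻¹' s ∩ U) := by
    intro s
    rw [Measure.smul_apply, Measure.map_apply hF MeasurableSet.of_discrete,
      Measure.restrict_apply MeasurableSet.of_discrete, smul_eq_mul]
  have hinv : (ν U)⁻¹ ≠ 0 := by simp
  have hz : ∀ s : Set κ.out, ((ν U)⁻¹ • (ν.restrict U).map F) s = 0 ↔ ν (F ⁻¹' s ∩ U) = 0 := by
    intro s
    rw [happ, mul_eq_zero]
    simp
  refine ⟨(ν U)⁻¹ • (ν.restrict U).map F, ?_, ?_, ?_⟩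
  · rw [happ]
    simp only [Set.preimage_univ, Set.univ_inter]
    exact ENNReal.inv_mul_cancel hU (measure_ne_top _ _)
  · intro y
    rw [hz]
    refine measure_mono_null ?_ (hnull (e.symm y).1 (e.symm y).2)
    rintro x ⟨hx, hxU⟩
    have : f x = e.symm y := by
      rw [Equiv.eq_symm_apply]; exact hx
    rw [← this]
    exact hf x hxU
  · intro 𝓜 hM hMn
    rw [hz]
    by_contra hne
    have hin : #((fun A : Set κ.out => F ⁻¹' A ∩ U) '' 𝓜) ∈ K := by
      refine ⟨_, rfl, ?_, ?_⟩
      · rintro _ ⟨A, hA, rfl⟩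
        exact (hz A).1 (hMn A hA)
      · convert hne using 2
        ext x
        simp only [Set.mem_sUnion, Set.mem_image, Set.mem_inter_iff, Set.mem_preimage]
        constructor
        · rintro ⟨_, ⟨A, hA, rfl⟩, hx⟩
          exact ⟨⟨A, hA, hx.1⟩, hx.2⟩
        · rintro ⟨⟨A, hA, hx⟩, hxU⟩
          exact ⟨_, ⟨A, hA, rfl⟩, hx, hxU⟩
    exact absurd (csInf_le' hin) (not_le.2 (Cardinal.mk_image_le.trans_lt hM))

lemma aux_atomic {Ω : Type u} [MeasurableSpace Ω] [DiscreteMeasurableSpace Ω] (μ : Measure Ω)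
    [IsFiniteMeasure μ]
    (hΩ : ∀ τ : Cardinal.{u}, IsRealValuedMeasurableCardinal τ → #Ω < τ) :
    ∃ C : Set Ω, C.Countable ∧ μ Cᶜ = 0 := by
  refine ⟨{x | 0 < μ {x}}, ?_, ?_⟩
  · apply Measure.countable_meas_pos_of_disjoint_iUnion (μ := μ) (As := fun x : Ω => ({x} : Set Ω))
    · intro i; exact measurableSet_singleton _
    · intro i j hij; simpa [Function.onFun] using hij
  · by_contra hne
    obtain ⟨τ, hτ, hle⟩ := aux_rvm (μ.restrict {x | 0 < μ {x}}ᶜ) (by simpa using hne) (by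
      intro x
      rw [Measure.restrict_apply MeasurableSet.of_discrete]
      by_cases hx : 0 < μ {x}
      · convert measure_empty (μ := μ)
        ext y
        simp only [Set.mem_inter_iff, Set.mem_singleton_iff, Set.mem_compl_iff, Set.mem_ofPred_eq,
          Set.mem_empty_iff_false, iff_false, not_and, not_not]
        rintro rfl; exact hx
      · exact measure_mono_null Set.inter_subset_left (by simpa using hx))
    exact absurd (hΩ τ hτ) (not_lt.2 hle)

lemma aux_term {Ω : Type u} [MetricSpace Ω] [MeasurableSpace Ω]
    [DiscreteMeasurableSpace Ω] (r : ℝ)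
    (hd : ∀ x y : Ω, dist x y = 0 ∨ dist x y = r)
    (μt : Measure (Ω × Bool)) [IsProbabilityMeasure μt] (k : ℕ → ℕ)
    (hk : Tendsto k atTop atTop)
    (hk0 : Tendsto (fun n : ℕ => (k n : ℝ) / n) atTop (nhds 0)) (x : Ω) :
    ∃ ε : ℕ → ℝ≥0∞, Tendsto ε atTop (nhds 0) ∧
      (∀ n, ε n ≤ μt (({x} : Set Ω) ×ˢ (univ : Set Bool))) ∧
      ∀ n (π : Equiv.Perm (Fin n)),
        ∑ b : Bool, Measure.pi (fun _ : Fin n => μt) {σ | kNNLabel n (k n) σ π x ≠ b} *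
          μt {(x, b)} ≤ min (μt {(x, true)}) (μt {(x, false)}) + ε n := by
  have main : ∀ b : Bool, μt {(x, !b)} < μt {(x, b)} →
      ∃ ε : ℕ → ℝ≥0∞, Tendsto ε atTop (nhds 0) ∧
      (∀ n, ε n ≤ μt (({x} : Set Ω) ×ˢ (univ : Set Bool))) ∧
      ∀ n (π : Equiv.Perm (Fin n)),
        Measure.pi (fun _ : Fin n => μt) {σ | kNNLabel n (k n) σ π x ≠ b} * μt {(x, b)} +
        Measure.pi (fun _ : Fin n => μt) {σ | kNNLabel n (k n) σ π x ≠ !b} * μt {(x, !b)}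
         ≤ μt {(x, !b)} + ε n := by
    intro b hlt
    obtain ⟨δ, hδ, hb⟩ := aux_wrong_bound μt k hk hk0 x b hlt
    refine ⟨fun n => min (δ n) 1 * μt {(x, b)}, ?_, ?_, ?_⟩
    · have h1 : Tendsto (fun n => min (δ n) 1) atTop (nhds (min 0 1)) := hδ.min tendsto_const_nhds
      have h2 := ENNReal.Tendsto.mul_const (b := μt {(x, b)}) h1 (Or.inr (measure_ne_top _ _))
      simpa using h2
    · intro n
      calc min (δ n) 1 * μt {(x, b)} ≤ 1 * μt {(x, b)} := by gcongr; exact min_le_right _ _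
        _ ≤ _ := by rw [one_mul]; apply measure_mono; simp
    · intro n π
      rw [add_comm]
      refine add_le_add ?_ ?_
      · calc _ ≤ 1 * μt {(x, !b)} := by gcongr; exact prob_le_one
          _ = _ := one_mul _
      · exact mul_le_mul_left (le_min (hb n π) prob_le_one) _
  rcases lt_trichotomy (μt {(x, false)}) (μt {(x, true)}) with h | h | h
  · obtain ⟨ε, h1, h2, h3⟩ := main true h
    refine ⟨ε, h1, h2, fun n π => ?_⟩
    rw [Fintype.sum_bool, min_eq_right h.le]
    exact h3 n π
  · refine ⟨fun _ => 0, tendsto_const_nhds, fun _ => zero_le, fun n π => ?_⟩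
    rw [Fintype.sum_bool, h, min_self, add_zero, ← add_mul]
    have hc : {σ : Fin n → Ω × Bool | kNNLabel n (k n) σ π x ≠ false} =
        {σ : Fin n → Ω × Bool | kNNLabel n (k n) σ π x ≠ true}ᶜ := by
      ext σ; simp
    rw [hc, measure_add_measure_compl (aux_label_measurable r hd n (k n) π x true), measure_univ,
      one_mul]
  · obtain ⟨ε, h1, h2, h3⟩ := main false h
    refine ⟨ε, h1, h2, fun n π => ?_⟩
    rw [Fintype.sum_bool, min_eq_left h.le, add_comm (_ * _)]
    exact h3 n π

lemma aux_backward {Ω : Type u} [MetricSpace Ω] [MeasurableSpace Ω]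
    [DiscreteMeasurableSpace Ω] (r : ℝ)
    (hd : ∀ x y : Ω, dist x y = 0 ∨ dist x y = r)
    (hΩ : ∀ τ : Cardinal.{u}, IsRealValuedMeasurableCardinal τ → #Ω < τ)
    (μt : Measure (Ω × Bool)) [IsProbabilityMeasure μt] (k : ℕ → ℕ)
    (hk : Tendsto k atTop atTop)
    (hk0 : Tendsto (fun n : ℕ => (k n : ℝ) / n) atTop (nhds 0)) :
    Tendsto (fun n : ℕ => kNNError μt n (k n)) atTop (nhds (bayesError μt)) := by
  obtain ⟨C, hC, hC0⟩ := aux_atomic (μt.map Prod.fst) hΩ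
  rw [Measure.map_apply measurable_fst MeasurableSet.of_discrete] at hC0
  have : Countable C := hC
  choose ε hε0 hεle hε using fun x : C => aux_term r hd μt k hk hk0 (x : Ω)
  let M : ℝ≥0∞ := ∑' x : C, min (μt {((x : Ω), true)}) (μt {((x : Ω), false)})
  -- the sum of the errors
  have hsum : Tendsto (fun n => ∑' x : C, ε x n) atTop (nhds 0) := by
    have hb : ∑' x : C, μt (({(x : Ω)} : Set Ω) ×ˢ (univ : Set Bool)) ≠ ∞ := by
      have := tsum_measure_le_measure_univ (μ := μt)
        (s := fun x : C => (({(x : Ω)} : Set Ω) ×ˢ (univ : Set Bool)))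
        (fun x => (aux_discrete _).nullMeasurableSet) (by
          intro x y hxy
          apply Disjoint.aedisjoint
          rw [Set.disjoint_left]
          rintro ⟨z, b⟩ h1 h2
          simp at h1 h2
          exact hxy (Subtype.ext (h1.symm.trans h2)))
      exact ne_top_of_le_ne_top (measure_ne_top μt _) this
    let _ : MeasurableSpace C := ⊤
    have := tendsto_lintegral_of_dominated_convergence (μ := (Measure.count : Measure C))
      (F := fun n x => ε x n) (f := fun _ => 0)
      (fun x => μt (({(x : Ω)} : Set Ω) ×ˢ (univ : Set Bool)))
      (fun n => Measurable.of_discrete) (fun n => ae_of_all _ fun x => hεle x n)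
      (by rwa [lintegral_count]) (ae_of_all _ fun x => hε0 x)
    simpa [lintegral_count] using this
  have hM : M ≤ bayesError μt := by
    refine le_iInf₂ fun T hT => ?_
    calc M ≤ ∑' x : C, μt {((x : Ω), !T x)} := by
          apply ENNReal.tsum_le_tsum
          intro x
          cases T x
          · exact min_le_left _ _
          · exact min_le_right _ _
      _ = μt (⋃ x : C, {((x : Ω), !T x)}) := by
          rw [measure_iUnion]
          · intro x y hxy
            simp only [Function.onFun, Set.disjoint_singleton, ne_eq, Prod.mk.injEq, not_and]
            intro h; exact absurd (Subtype.ext h) hxy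
          · intro x; exact aux_discrete _
      _ ≤ _ := by
          apply measure_mono
          intro p hp
          simp only [Set.mem_iUnion, Set.mem_singleton_iff] at hp
          obtain ⟨x, rfl⟩ := hp
          simp
  have hup : ∀ n, kNNError μt n (k n) ≤ bayesError μt + ∑' x : C, ε x n := by
    intro n
    refine le_trans ?_ (add_le_add_left hM _)
    apply aux_err_le
    intro π
    have hsub : {q : (Fin n → Ω × Bool) × (Ω × Bool) | kNNLabel n (k n) q.1 π q.2.1 ≠ q.2.2} ⊆
        ((Set.univ : Set (Fin n → Ω × Bool)) ×ˢ (Prod.fst ⁻¹' Cᶜ)) ∪ ⋃ x : C, ⋃ b : Bool,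
          {σ : Fin n → Ω × Bool | kNNLabel n (k n) σ π x ≠ b} ×ˢ {((x : Ω), b)} := by
      rintro ⟨σ, x, b⟩ hq
      by_cases hx : x ∈ C
      · right
        simp only [Set.mem_iUnion]
        exact ⟨⟨x, hx⟩, b, hq, rfl⟩
      · left
        exact ⟨trivial, hx⟩
    calc _ ≤ _ := measure_mono hsub
      _ ≤ _ := measure_union_le _ _
      _ ≤ 0 + ∑' x : C, (min (μt {((x : Ω), true)}) (μt {((x : Ω), false)}) + ε x n) := by
          refine add_le_add ?_ ?_
          · rw [Measure.prod_prod, hC0, mul_zero]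
          · refine (measure_iUnion_le _).trans (ENNReal.tsum_le_tsum fun x => ?_)
            refine (measure_iUnion_le _).trans ?_
            rw [tsum_fintype]
            simp only [Measure.prod_prod]
            exact hε x n π
      _ = _ := by rw [zero_add, ENNReal.tsum_add]
  refine tendsto_of_tendsto_of_tendsto_of_le_of_le tendsto_const_nhds ?_
    (fun n => aux_err_ge μt n (k n)) hup
  simpa using hsum.const_add (bayesError μt)

lemma aux_forward {Ω : Type u} [MetricSpace Ω] [MeasurableSpace Ω]
    [DiscreteMeasurableSpace Ω] (r : ℝ)
    (hd : ∀ x y : Ω, dist x y = 0 ∨ dist x y = r)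
    (ν : Measure Ω) [IsProbabilityMeasure ν] (hν : ∀ x, ν {x} = 0) :
    ∃ μt : Measure (Ω × Bool), IsProbabilityMeasure μt ∧ bayesError μt = 0 ∧
      ∃ c : ℝ≥0∞, 0 < c ∧ ∀ n k : ℕ, 0 < k → k ≤ n → c ≤ kNNError μt n k := by
  classical
  obtain ⟨a⟩ : Nonempty Ω := by
    by_contra h
    rw [not_nonempty_iff] at h
    have := measure_univ (μ := ν)
    rw [Set.univ_eq_empty_iff.2 h, measure_empty] at this
    exact zero_ne_one this
  have hmk : Measurable (fun x : Ω => (x, false)) := Measurable.of_discrete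
  let μt : Measure (Ω × Bool) :=
    ENNReal.ofReal (3/4) • Measure.dirac (a, true) + ENNReal.ofReal (1/4) • ν.map (fun x => (x, false))
  have happ : ∀ s, μt s = ENNReal.ofReal (3/4) * s.indicator 1 (a, true) +
      ENNReal.ofReal (1/4) * ν {x | (x, false) ∈ s} := by
    intro s
    simp only [μt, Measure.add_apply, Measure.smul_apply, smul_eq_mul]
    rw [Measure.dirac_apply' _ (aux_discrete s), Measure.map_apply hmk (aux_discrete s)]
    rfl
  have hprob : IsProbabilityMeasure μt := by
    constructor
    rw [happ]
    simp only [Set.indicator_univ, Set.mem_univ, Pi.one_apply, mul_one, Set.ofPred_true, measure_univ]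
    rw [← ENNReal.ofReal_add (by norm_num) (by norm_num)]
    norm_num
  refine ⟨μt, hprob, ?_, ?_⟩
  · rw [← nonpos_iff_eq_zero]
    refine (iInf₂_le (fun x => decide (x = a)) Measurable.of_discrete).trans ?_
    rw [happ]
    simp [hν]
  · obtain ⟨B, hB⟩ : ∃ B : Set (Ω × Bool), B = {p | p.2 = true} := ⟨_, rfl⟩
    obtain ⟨B', hB'⟩ : ∃ B : Set (Ω × Bool), B = {p | p.2 = false} := ⟨_, rfl⟩
    have hlt : μt B' < μt B := by
      rw [happ, happ]
      simp only [hB, hB', Set.mem_ofPred_eq, Set.indicator]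
      simp only [Bool.true_eq_false, if_false, if_true, Bool.false_eq_true, Set.ofPred_true,
        Set.ofPred_false, measure_univ, measure_empty, Pi.one_apply, mul_one, mul_zero, zero_add, add_zero]
      exact (ENNReal.ofReal_lt_ofReal_iff (by norm_num)).2 (by norm_num)
    obtain ⟨ρ, hρ, hch⟩ := aux_chernoff μt B B' (aux_discrete _) (aux_discrete _) (by
      rw [Set.disjoint_left]; rintro ⟨x, b⟩ h1 h2; simp [hB, hB'] at h1 h2; simp [h1] at h2) hlt
    refine ⟨ENNReal.ofReal (1/4) * (1 - ρ), ?_, ?_⟩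
    · apply ENNReal.mul_pos
      · simp
      · simpa [tsub_eq_zero_iff_le] using hρ
    intro n k hk hkn
    apply aux_err_ge'
    intro π
    set J : Finset (Fin n) := Finset.univ.filter fun i => (π i : ℕ) < k with hJ
    have hJc : J.card = k := aux_card_lt π hkn
    let Bad : Set (Fin n → Ω × Bool) :=
      {σ | (J.filter fun i => σ i ∈ B).card ≤ (J.filter fun i => σ i ∈ B').card}
    have hBad : MeasurableSet Bad := by
      have hm : ∀ D : Set (Ω × Bool), Measurable
          (fun σ : Fin n → Ω × Bool => (J.filter fun i => σ i ∈ D).card) := by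
        intro D
        simp only [Finset.card_filter]
        apply Finset.measurable_fun_sum
        intro i _
        exact Measurable.ite (measurable_pi_apply i (aux_discrete D)) measurable_const measurable_const
      exact measurableSet_le (hm B) (hm B')
    have hBadle : Measure.pi (fun _ : Fin n => μt) Bad ≤ ρ := by
      refine (hch n J).trans ?_
      rw [hJc]
      exact pow_le_of_le_one zero_le hρ.le hk.ne'
    have hgood : 1 - ρ ≤ Measure.pi (fun _ : Fin n => μt) Badᶜ := by
      rw [prob_compl_eq_one_sub hBad]
      exact tsub_le_tsub_left hBadle _
    have := aux_lower (Measure.pi fun _ : Fin n => μt) μt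
          {q : (Fin n → Ω × Bool) × (Ω × Bool) | kNNLabel n k q.1 π q.2.1 ≠ q.2.2}
          (Badᶜ.indicator fun _ => ENNReal.ofReal (1/4)) (by
        intro σ
        by_cases hσ : σ ∈ Badᶜ
        swap
        · rw [Set.indicator_of_notMem hσ]; exact zero_le
        rw [Set.indicator_of_mem hσ, happ]
        refine le_add_left ?_
        let F : Finset Ω := Finset.univ.image fun i => (σ i).1
        have hF : ν (F : Set Ω)ᶜ = 1 := by
          rw [prob_compl_eq_one_iff MeasurableSet.of_discrete]
          have hF' : (F : Set Ω) = ⋃ x ∈ F, {x} := by ext y; simp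
          rw [hF']
          exact (measure_biUnion_null_iff F.countable_toSet).2 fun x _ => hν x
        calc ENNReal.ofReal (1/4) = ENNReal.ofReal (1/4) * ν (F : Set Ω)ᶜ := by rw [hF, mul_one]
          _ ≤ _ := by
            gcongr
            intro x hx
            have hx' : ∀ i, (σ i).1 ≠ x := by
              intro i h; apply hx; simp only [F, Finset.coe_image, Finset.coe_univ]; exact ⟨i, trivial, h⟩
            have hn := aux_neighbours (k := k) σ π x r Finset.univ
              (fun i _ => (hd x (σ i).1).resolve_left fun h' => hx' i (dist_eq_zero.1 h').symm)
              (fun i hi => absurd (Finset.mem_univ i) hi) k hJc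
            simp only [Set.mem_preimage, Set.mem_ofPred_eq]
            intro hfalse
            apply hσ
            rw [hn] at hfalse
            have hlc := aux_label_count σ J hJc true (by rw [hfalse]; simp)
            simpa [Bad, hB, hB'] using hlc)
    refine le_trans ?_ this
    rw [lintegral_indicator_const hBad.compl]
    gcongr

theorem kNN_universallyConsistent_iff_card_lt_rvm_of_twoValued_metric
    (Ω : Type u) [MetricSpace Ω] (r : ℝ) (hr : 0 < r)
    (hd : ∀ x y : Ω, dist x y = 0 ∨ dist x y = r) :
    kNNUniversallyConsistent Ω ↔
      ∀ τ : Cardinal.{u}, IsRealValuedMeasurableCardinal τ → #Ω < τ := by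
  have hdisc : DiscreteTopology Ω := by
    refine DiscreteTopology.of_forall_le_dist hr ?_
    intro x y hxy
    exact ((hd x y).resolve_left fun h => hxy (dist_eq_zero.1 h)).ge
  let _ : MeasurableSpace Ω := borel Ω
  have hB : BorelSpace Ω := ⟨rfl⟩
  have hDM : DiscreteMeasurableSpace Ω := ⟨fun s => (isOpen_discrete s).measurableSet⟩
  constructor
  · intro h τ hτ
    by_contra hle
    rw [not_lt] at hle
    obtain ⟨m, hm1, hm2, -⟩ := hτ
    obtain ⟨f⟩ : Nonempty (τ.out ↪ Ω) := by
      rw [← Cardinal.le_def, Cardinal.mk_out]; exact hle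
    let _ : MeasurableSpace τ.out := ⊤
    have hf : Measurable f := Measurable.of_discrete
    have : IsProbabilityMeasure (m.map f) := by
      constructor
      rw [Measure.map_apply hf MeasurableSet.univ]; exact hm1
    obtain ⟨μt, hμ, hb, c, hc, hge⟩ := aux_forward r hd (m.map f) (by
      intro x
      rw [Measure.map_apply hf (measurableSet_singleton x)]
      by_cases hx : ∃ y, f y = x
      · obtain ⟨y, rfl⟩ := hx
        refine measure_mono_null ?_ (hm2 y)
        intro z hz
        exact f.injective hz
      · convert measure_empty (μ := m)
        ext z
        simp only [Set.mem_preimage, Set.mem_singleton_iff, Set.mem_empty_iff_false, iff_false]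
        exact fun hz => hx ⟨z, hz⟩)
    have hk : Tendsto Nat.sqrt atTop atTop := by
      refine tendsto_atTop.2 fun b => ?_
      filter_upwards [eventually_ge_atTop (b * b)] with n hn
      exact Nat.le_sqrt.2 hn
    have hk0 : Tendsto (fun n : ℕ => (Nat.sqrt n : ℝ) / n) atTop (nhds 0) := by
      have h1 : Tendsto (fun n : ℕ => (1 : ℝ) / (Nat.sqrt n : ℝ)) atTop (nhds 0) :=
        tendsto_one_div_atTop_nhds_zero_nat.comp hk
      refine tendsto_of_tendsto_of_tendsto_of_le_of_le' tendsto_const_nhds h1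
        (Eventually.of_forall fun n => by positivity) ?_
      filter_upwards [eventually_gt_atTop 0] with n hn
      have h2 : 0 < Nat.sqrt n := Nat.sqrt_pos.2 hn
      rw [div_le_div_iff₀ (by positivity) (by positivity), one_mul]
      exact_mod_cast Nat.sqrt_le n
    have hT := h Nat.sqrt hk hk0 μt hμ
    rw [show @bayesError Ω (borel Ω) μt = 0 from hb] at hT
    have hev := (tendsto_order.1 hT).2 c hc
    obtain ⟨n, hn, hn0⟩ := (hev.and (eventually_gt_atTop 0)).exists
    exact absurd hn (not_lt.2 (hge n _ (Nat.sqrt_pos.2 hn0) (Nat.sqrt_le_self n)))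
  · intro hΩ k hk hk0 μt hμ
    exact aux_backward r hd hΩ μt k hk hk0

end
end

section
/- Let Ω be a metric space, let τ be a two-valued measurable cardinal, and suppose |Ω| ≥ τ. Then there exist a real number r > 0 and a subset Y ⊆ Ω of cardinality τ such that the distance between any two distinct points of Y equals r. -/
open MeasureTheory Set Cardinal
open scoped ENNReal

noncomputable section

universe u

/-- A cardinal `τ` is *two-valued measurable* if a set of cardinality `τ` carries a
probability measure defined on all subsets, vanishing on singletons, taking only the
values `0` and `1`, and whose ideal of null sets is closed under unions of fewer than
`τ` members. -/
def IsTwoValuedMeasurableCardinal (τ : Cardinal.{u}) : Prop :=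
  ∃ μ : @Measure τ.out ⊤,
    μ Set.univ = 1 ∧
    (∀ x : τ.out, μ {x} = 0) ∧
    (∀ A : Set τ.out, μ A = 0 ∨ μ A = 1) ∧
    ∀ 𝒩 : Set (Set τ.out), #𝒩 < τ → (∀ A ∈ 𝒩, μ A = 0) → μ (⋃₀ 𝒩) = 0

/-- **Lemma.** Let `Ω` be a metric space, `τ` a two-valued measurable cardinal, and
`|Ω| ≥ τ`.  Then there exist `r > 0` and a subset `Y ⊆ Ω` of cardinality `τ` on which
the metric takes the constant value `r` between distinct points. -/
theorem exists_equilateral_subset_of_twoValuedMeasurable_le_card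
    (Ω : Type u) [MetricSpace Ω] (τ : Cardinal.{u})
    (hτ : IsTwoValuedMeasurableCardinal τ) (hcard : τ ≤ #Ω) :
    ∃ (r : ℝ) (Y : Set Ω), 0 < r ∧ #Y = τ ∧
      ∀ x ∈ Y, ∀ y ∈ Y, x ≠ y → dist x y = r := by
  obtain ⟨μ, h1, h0, h01, hN⟩ := hτ
  letI : MeasurableSpace τ.out := ⊤
  have hms : ∀ A : Set τ.out, MeasurableSet A := fun A => trivial
  haveI : IsProbabilityMeasure μ := ⟨h1⟩
  have hul : ∀ s : Set τ.out, s ∈ ae μ ∨ sᶜ ∈ ae μ := by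
    intro s
    rcases h01 s with h | h
    · right
      rw [mem_ae_iff, compl_compl]; exact h
    · left
      rw [mem_ae_iff, prob_compl_eq_zero_iff (hms s)]; exact h
  have hconst : ∀ f : τ.out → ℝ, ∃ c, ∀ᵐ y ∂μ, f y = c := by
    intro f
    obtain ⟨c, hc⟩ := Filter.exists_eventuallyEq_const_of_forall_separating
      (l := ae μ) (f := f) MeasurableSet (fun U _ => hul (f ⁻¹' U))
    exact ⟨c, hc⟩
  have hle : #τ.out ≤ #Ω := by rwa [mk_out]
  obtain ⟨e⟩ := Cardinal.le_def _ _ |>.1 hle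
  choose ρ hρ using fun x => hconst (fun y => dist (e x) (e y))
  obtain ⟨r, hr⟩ := hconst ρ
  have hne : ∀ x, ∀ᵐ y ∂μ, y ≠ x := by
    intro x
    rw [ae_iff]; simpa using h0 x
  have hr0 : 0 < r := by
    obtain ⟨x, hx⟩ := hr.exists
    obtain ⟨y, hy, hyx⟩ := ((hρ x).and (hne x)).exists
    rw [← hx, ← hy]
    exact dist_pos.2 fun h => hyx (e.injective h).symm
  obtain ⟨Y, hY⟩ := zorn_subset
    {Y : Set τ.out | (∀ x ∈ Y, ρ x = r) ∧ Y.Pairwise fun x y => dist (e x) (e y) = r} (by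
      intro c hc hch
      refine ⟨⋃₀ c, ⟨?_, ?_⟩, fun s hs => subset_sUnion_of_mem hs⟩
      · rintro x ⟨s, hs, hx⟩
        exact (hc hs).1 x hx
      · exact (pairwise_sUnion hch.directedOn).2 fun s hs => (hc hs).2)
  have hYτ : ¬ #Y < τ := by
    intro hlt
    have hnull := hN ((fun x => {y | ¬ (dist (e x) (e y) = r ∧ y ≠ x)}) '' Y)
      (mk_image_le.trans_lt hlt) (by
        rintro _ ⟨x, hx, rfl⟩
        have := (hρ x).and (hne x)
        rw [hY.prop.1 x hx] at this
        exact ae_iff.1 this)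
    have h2 := measure_eq_zero_iff_ae_notMem.1 hnull
    obtain ⟨y, hy, hyr⟩ := (h2.and hr).exists
    have hy' : ∀ x ∈ Y, dist (e x) (e y) = r ∧ y ≠ x := by
      intro x hx
      by_contra h
      exact hy ⟨_, ⟨x, hx, rfl⟩, h⟩
    have hmem : y ∈ Y := by
      refine hY.le_of_ge (y := insert y Y) ⟨?_, ?_⟩ (subset_insert y Y) (mem_insert y Y)
      · rintro x (rfl | hx)
        · exact hyr
        · exact hY.prop.1 x hx
      · refine hY.prop.2.insert fun x hx _ => ⟨?_, (hy' x hx).1⟩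
        rw [dist_comm]; exact (hy' x hx).1
    exact (hy' y hmem).2 rfl
  refine ⟨r, e '' Y, hr0, ?_, ?_⟩
  · rw [mk_image_eq e.injective]
    exact le_antisymm ((mk_set_le Y).trans_eq (mk_out τ)) (not_lt.1 hYτ)
  · rintro _ ⟨x, hx, rfl⟩ _ ⟨y, hy, rfl⟩ hxy
    exact hY.prop.2 hx hy fun h => hxy (h ▸ rfl)

end
end

section
/- Let X be a metric space such that every Borel probability measure μ on X satisfies μ(supp μ) = 1. Then every Borel probability measure on X is supported on a separable subspace: there exists a separable closed subset of X of measure one. -/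
open MeasureTheory Set Metric Cardinal TopologicalSpace
open scoped ENNReal

noncomputable section

universe u

/-- The support of a Borel measure `μ` on a metric space: the set of points all of whose
open balls have positive measure. -/
def measSupport {X : Type u} [MetricSpace X] [MeasurableSpace X] (μ : Measure X) :
    Set X :=
  {x : X | ∀ ε : ℝ, 0 < ε → 0 < μ (ball x ε)}

/-- **Proposition.** Let `X` be a metric space such that every Borel probability measure
on `X` gives full measure to its support.  Then every Borel probability measure on `X`
is supported on a separable subspace: there is a separable closed subset of measure one. -/
theorem exists_separable_closed_full_measure_of_support_full
    (X : Type u) [MetricSpace X] [MeasurableSpace X] [BorelSpace X]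
    (h : ∀ μ : Measure X, IsProbabilityMeasure μ → μ (measSupport μ) = 1) :
    ∀ μ : Measure X, IsProbabilityMeasure μ →
      ∃ S : Set X, IsClosed S ∧ IsSeparable S ∧ μ S = 1 := by
  intro μ hμ
  have hcl : IsClosed (measSupport μ) := by
    rw [← isOpen_compl_iff, Metric.isOpen_iff]
    intro x hx
    simp only [measSupport, mem_compl_iff, mem_setOf_eq, not_forall] at hx
    obtain ⟨ε, hε, hx⟩ := hx
    refine ⟨ε / 2, by positivity, fun y hy hy' => hx ?_⟩
    refine lt_of_lt_of_le (hy' (ε / 2) (by positivity)) (measure_mono ?_)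
    refine ball_subset_ball' ?_
    have := mem_ball.1 hy
    linarith
  refine ⟨measSupport μ, hcl, ?_, h μ hμ⟩
  suffices hs : ∃ t, t ⊆ measSupport μ ∧ t.Countable ∧ measSupport μ ⊆ closure t by
    obtain ⟨t, -, ht, hst⟩ := hs
    exact ⟨t, ht, hst⟩
  apply UniformSpace.subset_countable_closure_of_almost_dense_set
  intro U hU
  obtain ⟨ε, hε, hεU⟩ := Metric.mem_uniformity_dist.1 hU
  obtain ⟨N, hN⟩ : ∃ N, Maximal
      (fun N : Set X => N ⊆ measSupport μ ∧ N.Pairwise (fun x y => ε ≤ dist x y)) N := by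
    apply zorn_subset
    intro c hc hchain
    refine ⟨⋃₀ c, ⟨sUnion_subset fun s hs => (hc hs).1, ?_⟩, fun s hs => subset_sUnion_of_mem hs⟩
    exact (pairwise_sUnion hchain.directedOn).2 fun s hs => (hc hs).2
  refine ⟨N, ?_, ?_⟩
  · have hc := Measure.countable_meas_pos_of_disjoint_iUnion (μ := μ)
      (As := fun x : N => ball (x : X) (ε / 2)) (fun x => measurableSet_ball) (by
        intro x y hxy
        apply ball_disjoint_ball
        have := hN.prop.2 x.2 y.2 (fun e => hxy (Subtype.ext e))
        linarith)
    have hu : {i : N | 0 < μ (ball (i : X) (ε / 2))} = Set.univ :=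
      eq_univ_of_forall fun i => hN.prop.1 i.2 _ (by positivity)
    rw [hu] at hc
    exact countable_coe_iff.1 (countable_univ_iff.1 hc)
  · intro x hx
    by_contra hcon
    have hfar : ∀ y ∈ N, ε ≤ dist y x := by
      intro y hy
      by_contra hlt
      exact hcon (mem_biUnion hy (hεU (not_le.1 hlt)))
    have hins : insert x N ⊆ N := hN.2 ⟨insert_subset hx hN.prop.1,
      hN.prop.2.insert fun y hy _ => ⟨by rw [dist_comm]; exact hfar y hy, hfar y hy⟩⟩
      (subset_insert x N)
    have := hfar x (hins (mem_insert x N))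
    rw [dist_self] at this
    linarith
end
end

section
/- Let X be a metric space and let μ be a Borel probability measure on X with μ(supp μ) < 1. Then there exists a real-valued measurable cardinal less than or equal to the density of X. -/
open MeasureTheory Set Metric Cardinal TopologicalSpace
open scoped ENNReal

noncomputable section

universe u

lemma step2_aux {S : Type u} (ν : @Measure S ⊤) (hfin : ν univ ≠ ⊤) (h0 : ν univ ≠ 0)
    (hs : ∀ x, ν {x} = 0) :
    ∃ τ : Cardinal.{u}, IsRealValuedMeasurableCardinal τ ∧ τ ≤ #S := by
  classical
  letI : MeasurableSpace S := ⊤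
  let P : Set Cardinal.{u} := {c | ∃ N : c.out → Set S, (∀ i, ν (N i) = 0) ∧ ν (⋃ i, N i) ≠ 0}
  have key : ∀ (ι : Type u) (N : ι → Set S), (∀ i, ν (N i) = 0) → ν (⋃ i, N i) ≠ 0 → #ι ∈ P := by
    intro ι N h1 h2
    have e : (#ι).out ≃ ι := Cardinal.outMkEquiv
    refine ⟨fun i => N (e i), fun i => h1 _, ?_⟩
    rwa [e.surjective.iUnion_comp N]
  have hS : #S ∈ P := key S (fun x => {x}) hs (by rw [iUnion_of_singleton]; exact h0)
  have hτP : sInf P ∈ P := csInf_mem ⟨_, hS⟩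
  refine ⟨sInf P, ?_, csInf_le' hS⟩
  have hmin : ∀ c < sInf P, c ∉ P := fun c hc => notMem_of_lt_csInf' hc
  generalize sInf P = τ at hτP hmin
  obtain ⟨N, hN, hU⟩ := hτP
  set W := ⋃ i, N i with hW
  have hne : W.Nonempty := nonempty_of_measure_ne_zero hU
  obtain ⟨x0, hx0⟩ := hne
  obtain ⟨i0, _⟩ := mem_iUnion.1 hx0
  let g : S → τ.out := fun x => if hx : ∃ i, x ∈ N i then hx.choose else i0
  have hg : ∀ x ∈ W, x ∈ N (g x) := by
    intro x hx
    have hx' : ∃ i, x ∈ N i := mem_iUnion.1 hx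
    simp only [g, dif_pos hx']
    exact hx'.choose_spec
  letI : MeasurableSpace τ.out := ⊤
  have hgm : Measurable g := measurable_from_top
  have hmap : ∀ A : Set τ.out, ((ν.restrict W).map g) A = ν (g ⁻¹' A ∩ W) := by
    intro A
    rw [Measure.map_apply hgm (by trivial), Measure.restrict_apply (by trivial)]
  have hWt : ν W ≠ ⊤ := ne_top_of_le_ne_top hfin (measure_mono (subset_univ _))
  refine ⟨(ν W)⁻¹ • ((ν.restrict W).map g), ?_, ?_, ?_⟩
  · rw [Measure.smul_apply, hmap]
    simp only [preimage_univ, univ_inter, smul_eq_mul]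
    exact ENNReal.inv_mul_cancel hU hWt
  · intro i
    rw [Measure.smul_apply, hmap]
    have : ν (g ⁻¹' {i} ∩ W) = 0 := by
      refine measure_mono_null ?_ (hN i)
      rintro x ⟨hx, hxW⟩
      have := hg x hxW
      rwa [show g x = i from hx] at this
    simp [this]
  · intro 𝒩 hc hnull
    rw [Measure.smul_apply, hmap]
    suffices ν (g ⁻¹' (⋃₀ 𝒩) ∩ W) = 0 by rw [this, smul_zero]
    by_contra hcon
    refine hmin _ hc (key 𝒩 (fun A => g ⁻¹' A.1 ∩ W) ?_ ?_)
    · rintro ⟨A, hA⟩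
      have := hnull A hA
      rw [Measure.smul_apply, hmap, smul_eq_mul, mul_eq_zero] at this
      exact this.resolve_left (ENNReal.inv_ne_zero.2 hWt)
    · rwa [sUnion_eq_iUnion, preimage_iUnion, iUnion_inter] at hcon

lemma step1_meas {X : Type u} [MetricSpace X] [MeasurableSpace X] [BorelSpace X]
    {D : Type u} [LinearOrder D] (U : D → Set X) (hU : ∀ d, IsOpen (U d)) (A : Set D) :
    MeasurableSet (⋃ a : A, (U a.1 \ ⋃ b : Iio a.1, U b.1)) := by
  let F : ℕ → D → Set X := fun n a => {x | ((n : ℝ≥0∞) + 1)⁻¹ ≤ infEDist x (U a)ᶜ} \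
    ⋃ b : Iio a, U b.1
  have hF : ∀ n a, IsClosed (F n a) := fun n a =>
    (isClosed_le continuous_const continuous_infEDist).sdiff (isOpen_iUnion fun b => hU _)
  have hdisj : ∀ n a b x y, x ∈ F n a → y ∈ F n b → a < b → ((n : ℝ≥0∞) + 1)⁻¹ ≤ edist x y := by
    intro n a b x y hx hy hab
    refine le_trans hx.1 (infEDist_le_edist_of_mem ?_)
    intro hya
    exact hy.2 (mem_iUnion.2 ⟨⟨a, hab⟩, hya⟩)
  have hcl : ∀ n, IsClosed (⋃ a : A, F n a.1) := by
    intro n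
    refine LocallyFinite.isClosed_iUnion ?_ (fun a => hF n a.1)
    intro z
    have hpos : (0 : ℝ≥0∞) < ((n : ℝ≥0∞) + 1)⁻¹ / 2 :=
      ENNReal.half_pos (ENNReal.inv_ne_zero.2 (by finiteness))
    refine ⟨Metric.eball z (((n : ℝ≥0∞) + 1)⁻¹ / 2), Metric.eball_mem_nhds _ hpos, ?_⟩
    refine Set.Subsingleton.finite ?_
    rintro a ⟨x, hx, hxz⟩ b ⟨y, hy, hyz⟩
    have hlt : edist x y < ((n : ℝ≥0∞) + 1)⁻¹ := by
      calc edist x y ≤ edist x z + edist y z := edist_triangle_right x y z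
        _ < _ := ENNReal.add_lt_add hxz hyz
        _ = _ := ENNReal.add_halves _
    rcases lt_trichotomy a.1 b.1 with h | h | h
    · exact absurd (hdisj n _ _ _ _ hx hy h) hlt.not_ge
    · exact Subtype.ext h
    · exact absurd (hdisj n _ _ _ _ hy hx h) (by rw [edist_comm]; exact hlt.not_ge)
  have : (⋃ a : A, (U a.1 \ ⋃ b : Iio a.1, U b.1)) = ⋃ n, ⋃ a : A, F n a.1 := by
    rw [iUnion_comm]
    refine iUnion_congr fun a => ?_
    simp only [F, ← iUnion_diff]
    congr 1
    ext x
    simp only [mem_iUnion, mem_setOf_eq]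
    constructor
    · intro hx
      have hne : infEDist x (U a)ᶜ ≠ 0 := by
        intro h0
        have := (mem_iff_infEDist_zero_of_closed (hU a).isClosed_compl).2 h0
        exact this hx
      obtain ⟨n, hn⟩ := ENNReal.exists_inv_nat_lt hne
      exact ⟨n, le_trans (ENNReal.inv_le_inv.2 le_self_add) hn.le⟩
    · rintro ⟨n, hn⟩
      by_contra hx
      rw [infEDist_zero_of_mem (show x ∈ (U a)ᶜ from hx)] at hn
      exact absurd hn (by simp)
  rw [this]
  exact MeasurableSet.iUnion fun n => (hcl n).measurableSet

lemma step1_aux {X : Type u} [MetricSpace X] [MeasurableSpace X] [BorelSpace X]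
    (μ : Measure X) [IsProbabilityMeasure μ] {D : Type u} (U : D → Set X)
    (hU : ∀ d, IsOpen (U d)) (h0 : ∀ d, μ (U d) = 0) (h1 : μ (⋃ d, U d) ≠ 0) :
    ∃ ν : @Measure D ⊤, ν univ ≠ ⊤ ∧ ν univ ≠ 0 ∧ ∀ x, ν {x} = 0 := by
  classical
  obtain ⟨_, _⟩ := exists_wellOrder D
  set W := ⋃ d, U d with hW
  have hWm : MeasurableSet W := (isOpen_iUnion hU).measurableSet
  obtain ⟨x0, hx0⟩ := nonempty_of_measure_ne_zero h1
  obtain ⟨d0, _⟩ := mem_iUnion.1 hx0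
  have hwf : WellFounded ((· < ·) : D → D → Prop) := wellFounded_lt
  have hex : ∀ x : X, ∃ d, (x ∈ W → x ∈ U d \ ⋃ b : Iio d, U b.1) ∧ (x ∉ W → d = d0) := by
    intro x
    by_cases hx : x ∈ W
    · have hne : {d | x ∈ U d}.Nonempty := mem_iUnion.1 hx
      refine ⟨hwf.min _ hne, fun _ => ⟨hwf.min_mem _ hne, ?_⟩, fun h => absurd hx h⟩
      intro hxx
      obtain ⟨⟨b, hb⟩, hxb⟩ := mem_iUnion.1 hxx
      exact hwf.not_lt_min {d | x ∈ U d} hxb hb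
    · exact ⟨d0, fun h => absurd h hx, fun _ => rfl⟩
  choose f hf hf' using hex
  letI : MeasurableSpace D := ⊤
  have hfm : Measurable f := by
    intro A _
    have : f ⁻¹' A = (⋃ a : A, (U a.1 \ ⋃ b : Iio a.1, U b.1)) ∪ (Wᶜ ∩ {_x | d0 ∈ A}) := by
      ext x
      by_cases hx : x ∈ W
      · have hfx := hf x hx
        simp only [mem_preimage, mem_union, mem_inter_iff, mem_compl_iff, hx, not_true_eq_false,
          false_and, or_false]
        constructor
        · intro hA
          exact mem_iUnion.2 ⟨⟨f x, hA⟩, hfx⟩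
        · intro hxx
          obtain ⟨⟨a, ha⟩, hxa, hxa'⟩ := mem_iUnion.1 hxx
          have : f x = a := by
            rcases lt_trichotomy (f x) a with h | h | h
            · exact absurd (mem_iUnion.2 ⟨⟨f x, h⟩, hfx.1⟩) hxa'
            · exact h
            · exact absurd (mem_iUnion.2 ⟨⟨a, h⟩, hxa⟩) hfx.2
          rwa [this]
      · have h2 : x ∉ (⋃ a : A, (U a.1 \ ⋃ b : Iio a.1, U b.1)) := by
          intro hxx
          obtain ⟨a, hxa, _⟩ := mem_iUnion.1 hxx
          exact hx (mem_iUnion.2 ⟨_, hxa⟩)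
        rw [mem_union, or_iff_right h2, mem_preimage, hf' x hx]
        exact ⟨fun h => ⟨hx, h⟩, fun h => h.2⟩
    rw [this]
    exact (step1_meas U hU A).union (hWm.compl.inter (MeasurableSet.const _))
  have hmap : ∀ A : Set D, ((μ.restrict W).map f) A = μ (f ⁻¹' A ∩ W) := by
    intro A
    rw [Measure.map_apply hfm (by trivial), Measure.restrict_apply (hfm (by trivial))]
  refine ⟨(μ.restrict W).map f, ?_, ?_, ?_⟩
  · rw [hmap]; finiteness
  · rw [hmap]; simpa using h1
  · intro d
    rw [hmap]
    refine measure_mono_null ?_ (h0 d)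
    rintro x ⟨hx, hxW⟩
    have := (hf x hxW).1
    rwa [show f x = d from hx] at this

/-- **Proposition.** Let `X` be a metric space carrying a Borel probability measure `μ`
with `μ (supp μ) < 1`.  Then there is a real-valued measurable cardinal less than or
equal to the density of `X`. -/
theorem exists_rvm_le_density_of_support_not_full
    (X : Type u) [MetricSpace X] [MeasurableSpace X] [BorelSpace X]
    (μ : Measure X) [IsProbabilityMeasure μ] (h : μ (measSupport μ) < 1) :
    ∃ τ : Cardinal.{u}, IsRealValuedMeasurableCardinal τ ∧ τ ≤ densityCard X := by
  have hD : densityCard X ∈ {c : Cardinal.{u} | ∃ s : Set X, Dense s ∧ #s = c} :=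
    csInf_mem ⟨_, univ, dense_univ, rfl⟩
  obtain ⟨D, hDd, hDc⟩ := hD
  let U : D → Set X := fun d => ⋃ q : {q : ℚ // μ (ball d.1 (q : ℝ)) = 0}, ball d.1 (q.1 : ℝ)
  have hU : ∀ d, IsOpen (U d) := fun d => isOpen_iUnion fun q => isOpen_ball
  have h0 : ∀ d, μ (U d) = 0 := fun d => measure_iUnion_null fun q => q.2
  have hcov : (Set.univ : Set X) ⊆ measSupport μ ∪ ⋃ d, U d := by
    intro x _
    by_cases hx : x ∈ measSupport μ
    · exact Or.inl hx
    right
    simp only [measSupport, mem_setOf_eq, not_forall, not_lt, nonpos_iff_eq_zero] at hx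
    obtain ⟨ε, hε, hx⟩ := hx
    obtain ⟨d, hd, hxd⟩ := hDd.exists_dist_lt x (half_pos hε)
    obtain ⟨q, hq1, hq2⟩ := exists_rat_btwn hxd
    refine mem_iUnion.2 ⟨⟨d, hd⟩, mem_iUnion.2 ⟨⟨q, ?_⟩, hq1⟩⟩
    refine measure_mono_null (ball_subset_ball' ?_) hx
    rw [dist_comm]
    dsimp only
    linarith
  have h1 : μ (⋃ d, U d) ≠ 0 := by
    intro h1
    have := (measure_mono hcov).trans (measure_union_le (μ := μ) _ _)
    rw [h1, add_zero, measure_univ] at this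
    exact absurd h this.not_gt
  obtain ⟨ν, a, b, c⟩ := step1_aux μ U hU h0 h1
  rw [← hDc]
  exact step2_aux ν a b c

end
end

section
/- Let X be a metric space such that every Borel probability measure on X is supported on a separable subspace (some separable subset has measure one). Then every Borel probability measure μ on X is regular in the following sense: for every Borel set B ⊆ X and every ε > 0 there is a closed, precompact (totally bounded) subset K ⊆ B with μ(B \ K) < ε. -/
open MeasureTheory Set Metric TopologicalSpace
open scoped ENNReal

universe u

/-- **Proposition.** Let `X` be a metric space such that every Borel probability measure
on `X` is supported on a separable subspace (some separable subset has measure one).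
Then every Borel probability measure `μ` on `X` is regular: for every Borel set `B ⊆ X`
and every `ε > 0` there is a closed, totally bounded subset `K ⊆ B` with `μ (B \ K) < ε`. -/
theorem regular_of_separably_supported
    (X : Type u) [MetricSpace X] [MeasurableSpace X] [BorelSpace X]
    (h : ∀ μ : Measure X, IsProbabilityMeasure μ →
      ∃ S : Set X, IsSeparable S ∧ μ S = 1) :
    ∀ μ : Measure X, IsProbabilityMeasure μ →
      ∀ B : Set X, MeasurableSet B → ∀ ε : ℝ≥0∞, 0 < ε →
        ∃ K, K ⊆ B ∧ IsClosed K ∧ TotallyBounded K ∧ μ (B \ K) < ε := by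
  intro μ hμ B hB ε hε
  obtain ⟨S, ⟨c, hc, hSc⟩, hS⟩ := h μ hμ
  have hcn : c.Nonempty := by
    by_contra hne
    rw [Set.not_nonempty_iff_eq_empty] at hne
    subst hne
    rw [closure_empty, Set.subset_empty_iff] at hSc
    subst hSc
    simp at hS
  obtain ⟨v, rfl⟩ := hc.exists_eq_range hcn
  have hε2 : ε / 2 ≠ 0 := (ENNReal.half_pos hε.ne').ne'
  obtain ⟨δ, hδ, hδs⟩ := ENNReal.exists_pos_sum_of_countable' hε2 ℕ
  obtain ⟨F, hFB, hFc, hF⟩ := hB.exists_isClosed_sdiff_lt (measure_ne_top μ B) hε2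
  have key : ∀ n : ℕ, ∃ m : ℕ,
      μ (⋃ i ∈ Set.Iic m, closedBall (v i) (1 / ((n : ℝ) + 1)))ᶜ < δ n := by
    intro n
    have hr : (0 : ℝ) < 1 / ((n : ℝ) + 1) := by positivity
    set A : ℕ → Set X := fun m => ⋃ i ∈ Set.Iic m, closedBall (v i) (1 / ((n : ℝ) + 1)) with hA
    have hAc : ∀ m, IsClosed (A m) := fun m =>
      (Set.finite_Iic m).isClosed_biUnion fun i _ => isClosed_closedBall
    have hmono : Monotone A := fun a b hab =>
      Set.biUnion_subset_biUnion_left (Set.Iic_subset_Iic.2 hab)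
    have hU : S ⊆ ⋃ m, A m := by
      intro x hx
      obtain ⟨y, ⟨i, rfl⟩, hy⟩ := Metric.mem_closure_iff.1 (hSc hx) _ hr
      exact Set.mem_iUnion.2 ⟨i, Set.mem_biUnion (Set.mem_Iic.2 le_rfl) hy.le⟩
    have hU1 : μ (⋃ m, A m) = 1 :=
      le_antisymm prob_le_one (hS ▸ measure_mono hU)
    have hU0 : μ (⋂ m, (A m)ᶜ) = 0 := by
      rw [← Set.compl_iUnion]
      exact (prob_compl_eq_zero_iff (MeasurableSet.iUnion fun m => (hAc m).measurableSet)).2 hU1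
    have ht := tendsto_measure_iInter_atTop (μ := μ) (s := fun m => (A m)ᶜ)
      (fun m => (hAc m).measurableSet.compl.nullMeasurableSet)
      (fun a b hab => Set.compl_subset_compl.2 (hmono hab)) ⟨0, measure_ne_top _ _⟩
    rw [hU0] at ht
    exact (ht.eventually (gt_mem_nhds (hδ n))).exists
  choose m hm using key
  set T : Set X := ⋂ n : ℕ, ⋃ i ∈ Set.Iic (m n), closedBall (v i) (1 / ((n : ℝ) + 1)) with hT
  have hTc : IsClosed T := isClosed_iInter fun n =>
    (Set.finite_Iic (m n)).isClosed_biUnion fun i _ => isClosed_closedBall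
  have hTb : TotallyBounded T := by
    rw [Metric.totallyBounded_iff]
    intro r hr
    obtain ⟨n, hn⟩ := exists_nat_one_div_lt hr
    refine ⟨v '' Set.Iic (m n), (Set.finite_Iic _).image v, ?_⟩
    rw [Set.biUnion_image]
    refine (Set.iInter_subset _ n).trans ?_
    exact Set.iUnion₂_mono fun i _ => closedBall_subset_ball hn
  refine ⟨F ∩ T, Set.inter_subset_left.trans hFB, hFc.inter hTc,
    hTb.subset Set.inter_subset_right, ?_⟩
  have hTμ : μ Tᶜ < ε / 2 := by
    rw [hT, Set.compl_iInter]
    exact ((measure_iUnion_le _).trans (ENNReal.tsum_le_tsum fun n => (hm n).le)).trans_lt hδs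
  calc μ (B \ (F ∩ T)) ≤ μ ((B \ F) ∪ Tᶜ) := by
        apply measure_mono
        rintro x ⟨hxB, hx⟩
        by_cases hxF : x ∈ F
        · exact Or.inr fun hxT => hx ⟨hxF, hxT⟩
        · exact Or.inl ⟨hxB, hxF⟩
    _ ≤ μ (B \ F) + μ Tᶜ := measure_union_le _ _
    _ < ε / 2 + ε / 2 := ENNReal.add_lt_add hF hTμ
    _ = ε := ENNReal.add_halves ε
end

section
/- A metric space Ω has Nagata dimension 0 on the scale s = +∞ (in itself) if and only if Ω is non-archimedean, i.e. its metric satisfies the strong triangle inequality d(x,z) ≤ max{d(x,y), d(y,z)} for all x, y, z ∈ Ω. -/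
open Set Metric
open scoped ENNReal

noncomputable section

universe u

/-- A subset `X` of a metric space `Ω` has *Nagata dimension* `≤ δ` on the scale `+∞`
in `Ω` if every finite family of closed balls of `Ω` with centres in `X` admits a
subfamily of multiplicity `≤ δ + 1` which still covers the centres of all the original
balls.  A family of balls is recorded as a finite set of (centre, radius) pairs. -/
def NagataDimLEInfScale {Ω : Type u} [MetricSpace Ω] (X : Set Ω) (δ : ℕ) : Prop :=
  ∀ F : Finset (Ω × ℝ),
    (∀ p ∈ F, p.1 ∈ X ∧ 0 ≤ p.2) →
    ∃ G ⊆ F,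
      (∀ p ∈ F, ∃ q ∈ G, p.1 ∈ Metric.closedBall q.1 q.2) ∧
      ∀ z : Ω, (G.filter fun q => dist z q.1 ≤ q.2).card ≤ δ + 1

/-- The Nagata dimension (on the scale `+∞`) of a subset `X` of a metric space `Ω`,
with value `⊤` when it is infinite. -/
def nagataDimInfScale {Ω : Type u} [MetricSpace Ω] (X : Set Ω) : ℕ∞ :=
  sInf {d : ℕ∞ | ∃ δ : ℕ, d = (δ : ℕ∞) ∧ NagataDimLEInfScale X δ}

/-- **Example.** A metric space `Ω` has Nagata dimension `0` on the scale `+∞` (in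
itself) if and only if it is non-archimedean, i.e. the metric satisfies the strong
triangle inequality. -/
theorem nagataDimLEInfScale_zero_iff_nonarchimedean
    (Ω : Type u) [MetricSpace Ω] :
    NagataDimLEInfScale (Set.univ : Set Ω) 0 ↔
      ∀ x y z : Ω, dist x z ≤ max (dist x y) (dist y z) := by
  classical
  constructor
  · intro h x y z
    by_contra hc
    rw [not_le, max_lt_iff] at hc
    obtain ⟨h1, h2⟩ := hc
    obtain ⟨G, hGF, hcov, hmul⟩ := h {(x, dist x y), (z, dist y z)} (by simp)
    have hx : (x, dist x y) ∈ G := by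
      obtain ⟨q, hq, hxq⟩ := hcov (x, dist x y) (by simp)
      have := hGF hq
      simp only [Finset.mem_insert, Finset.mem_singleton] at this
      rcases this with rfl | rfl
      · exact hq
      · simp only [Metric.mem_closedBall] at hxq
        linarith
    have hz : (z, dist y z) ∈ G := by
      obtain ⟨q, hq, hxq⟩ := hcov (z, dist y z) (by simp)
      have := hGF hq
      simp only [Finset.mem_insert, Finset.mem_singleton] at this
      rcases this with rfl | rfl
      · simp only [Metric.mem_closedBall] at hxq
        rw [dist_comm] at hxq
        linarith
      · exact hq
    have hm := Finset.card_le_one.mp (hmul y) (x, dist x y)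
      (Finset.mem_filter.mpr ⟨hx, (dist_comm y x).le⟩) (z, dist y z)
      (Finset.mem_filter.mpr ⟨hz, le_refl _⟩)
    have hxz : x = z := congrArg Prod.fst hm
    subst hxz
    rw [dist_self] at h1
    exact absurd h1 (not_lt.mpr dist_nonneg)
  · intro hu F
    induction F using Finset.strongInduction with
    | H F ih =>
      intro hF
      rcases F.eq_empty_or_nonempty with rfl | hne
      · exact ⟨∅, by simp, by simp, by simp⟩
      obtain ⟨p, hp, hmax⟩ := F.exists_max_image (fun q => q.2) hne
      have hp0 := (hF p hp).2
      obtain ⟨G, hGF, hcov, hmul⟩ := ih (F.filter fun q => ¬ dist q.1 p.1 ≤ p.2)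
        (Finset.filter_ssubset.mpr ⟨p, hp, by simpa using hp0⟩)
        (fun q hq => hF q (Finset.mem_filter.mp hq).1)
      have hdis : ∀ z, dist z p.1 ≤ p.2 → ∀ q ∈ G, ¬ dist z q.1 ≤ q.2 := by
        intro z hz q hq hzq
        obtain ⟨hqF, hqp⟩ := Finset.mem_filter.mp (hGF hq)
        apply hqp
        refine (hu q.1 z p.1).trans (max_le ?_ hz)
        rw [dist_comm]
        exact hzq.trans (hmax q hqF)
      refine ⟨insert p G, ?_, ?_, ?_⟩
      · intro q hq
        rcases Finset.mem_insert.mp hq with rfl | hq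
        · exact hp
        · exact (Finset.mem_filter.mp (hGF hq)).1
      · intro q hq
        by_cases hqp : dist q.1 p.1 ≤ p.2
        · exact ⟨p, Finset.mem_insert_self _ _, hqp⟩
        · obtain ⟨r, hr, hqr⟩ := hcov q (Finset.mem_filter.mpr ⟨hq, hqp⟩)
          exact ⟨r, Finset.mem_insert_of_mem hr, hqr⟩
      · intro z
        refine Finset.card_le_one.mpr ?_
        intro a ha b hb
        obtain ⟨ha, haz⟩ := Finset.mem_filter.mp ha
        obtain ⟨hb, hbz⟩ := Finset.mem_filter.mp hb
        rcases Finset.mem_insert.mp ha with rfl | haG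
        · rcases Finset.mem_insert.mp hb with rfl | hb
          · rfl
          · exact absurd hbz (hdis z haz b hb)
        · rcases Finset.mem_insert.mp hb with rfl | hb
          · exact absurd haz (hdis z hbz a haG)
          · exact Finset.card_le_one.mp (hmul z) a (Finset.mem_filter.mpr ⟨haG, haz⟩) b
              (Finset.mem_filter.mpr ⟨hb, hbz⟩)

end
end

section
/- Let τ be any infinite cardinal and let J(τ) be the metric hedgehog of spininess τ. Then: (a) the Nagata dimension of J(τ) in itself is infinite on every scale s > 0; (b) J(τ) is nevertheless sigma-finite dimensional in the sense of Nagata, being the union of the singleton {0} together with the sets Xₙ = {points at distance ≥ 1/n from the centre}, each of which has Nagata dimension 1 in J(τ) on the scale 1/n. -/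
open Set Metric
open scoped ENNReal

noncomputable section

universe u

instance : Fact ((1 : ℝ≥0∞) ≤ 1) := ⟨le_rfl⟩

/-- A subset `X` of a metric space `Ω` has *Nagata dimension* `≤ δ` on the scale `s > 0`
in `Ω` if every finite family of closed balls of `Ω` with centres in `X` and radii `< s`
admits a subfamily of multiplicity `≤ δ + 1` which still covers the centres of all the
original balls.  A family of balls is recorded as a finite set of (centre, radius) pairs. -/
def NagataDimLE {Ω : Type u} [MetricSpace Ω] (X : Set Ω) (δ : ℕ) (s : ℝ) : Prop :=
  ∀ F : Finset (Ω × ℝ),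
    (∀ p ∈ F, p.1 ∈ X ∧ 0 ≤ p.2 ∧ p.2 < s) →
    ∃ G ⊆ F,
      (∀ p ∈ F, ∃ q ∈ G, p.1 ∈ Metric.closedBall q.1 q.2) ∧
      ∀ z : Ω, (G.filter fun q => dist z q.1 ≤ q.2).card ≤ δ + 1

/-- The metric hedgehog `J(ι)` of spininess `#ι`: the disjoint union of `#ι` copies of
`[0,1]` glued at `0`, with the geodesic metric (`|x - y|` on a common spine, `x + y`
across different spines).  It is realised as the set of functions `ι → ℝ` with values in
`[0,1]` and supported in at most one coordinate, inside `ℓ¹(ι)`, whose metric restricts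
to exactly the geodesic hedgehog metric on this set. -/
def Hedgehog (ι : Type u) : Type u :=
  { f : lp (fun _ : ι => ℝ) 1 //
      (∀ i, f i ∈ Set.Icc (0 : ℝ) 1) ∧ ∀ i j, f i ≠ 0 → f j ≠ 0 → i = j }

instance (ι : Type u) : MetricSpace (Hedgehog ι) := by
  unfold Hedgehog; infer_instance

/-- The centre (the point where all the spines are glued) of the hedgehog. -/
def Hedgehog.center (ι : Type u) : Hedgehog ι :=
  ⟨0, fun i => by simp, fun i j hi _ => absurd (by simp) hi⟩

section aux
variable {ι : Type u}

open Classical in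
def Hedgehog.mk (i : ι) (t : ℝ) (h : t ∈ Set.Icc (0 : ℝ) 1) : Hedgehog ι :=
  ⟨lp.single 1 i t, by
    constructor
    · intro j
      rw [lp.single_apply]
      by_cases hj : j = i
      · subst hj; simpa using h
      · simp [Pi.single_eq_of_ne hj]
    · intro j k hj hk
      rw [lp.single_apply] at hj hk
      have h1 : j = i := by
        by_contra hne; exact hj (by simp [Pi.single_eq_of_ne hne])
      have h2 : k = i := by
        by_contra hne; exact hk (by simp [Pi.single_eq_of_ne hne])
      rw [h1, h2]⟩

theorem Hedgehog.exists_mk [Nonempty ι] (x : Hedgehog ι) : ∃ i t h, x = Hedgehog.mk i t h := by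
  classical
  obtain ⟨f, h1, h2⟩ := x
  have : ∃ i, ∀ j, j ≠ i → f j = 0 := by
    by_cases h : ∃ i, f i ≠ 0
    · obtain ⟨i, hi⟩ := h
      refine ⟨i, fun j hj => ?_⟩
      by_contra hne
      exact hj (h2 j i hne hi)
    · push Not at h
      exact ⟨Classical.arbitrary ι, fun j _ => h j⟩
  obtain ⟨i, hi⟩ := this
  refine ⟨i, f i, h1 i, ?_⟩
  apply Subtype.ext
  apply lp.ext
  funext j
  simp only [Hedgehog.mk]
  rw [lp.single_apply]
  by_cases hj : j = i
  · subst hj; simp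
  · simp [Pi.single_eq_of_ne hj, hi j hj]

theorem Hedgehog.dist_same (i : ι) (t u : ℝ) (h h') :
    dist (Hedgehog.mk i t h) (Hedgehog.mk i u h') = |t - u| := by
  classical
  change dist (lp.single 1 i t : lp (fun _ : ι => ℝ) 1) (lp.single 1 i u) = _
  rw [dist_eq_norm, ← lp.single_sub, lp.norm_single (by norm_num)]
  rfl

theorem Hedgehog.dist_diff (i j : ι) (hij : i ≠ j) (t u : ℝ) (h h') :
    dist (Hedgehog.mk i t h) (Hedgehog.mk j u h') = t + u := by
  classical
  change dist (lp.single 1 i t : lp (fun _ : ι => ℝ) 1) (lp.single 1 j u) = _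
  rw [dist_eq_norm, lp.norm_eq_tsum_rpow (by norm_num), tsum_eq_sum (s := {i, j})]
  · rw [Finset.sum_pair hij]
    simp [Pi.single_apply, hij, hij.symm, abs_of_nonneg h.1, abs_of_nonneg h'.1]
  · intro b hb
    simp only [Finset.mem_insert, Finset.mem_singleton, not_or] at hb
    simp [Pi.single_apply, hb.1, hb.2]

theorem Hedgehog.mk_zero (i : ι) : Hedgehog.mk i 0 (by simp) = Hedgehog.center ι := by
  classical
  apply Subtype.ext
  simp [Hedgehog.mk, Hedgehog.center]

theorem Hedgehog.dist_center (i : ι) (t : ℝ) (h) :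
    dist (Hedgehog.mk i t h) (Hedgehog.center ι) = t := by
  rw [← Hedgehog.mk_zero i, Hedgehog.dist_same, sub_zero, abs_of_nonneg h.1]

theorem Hedgehog.spine_eq (i j : ι) (t u : ℝ) (h h')
    (hd : dist (Hedgehog.mk i t h) (Hedgehog.mk j u h') < u) : i = j := by
  by_contra hne
  rw [Hedgehog.dist_diff i j hne] at hd
  linarith [h.1]

theorem Hedgehog.partA [Infinite ι] (s : ℝ) (hs : 0 < s) (δ : ℕ) :
    ¬ NagataDimLE (Set.univ : Set (Hedgehog ι)) δ s := by
  classical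
  intro H
  obtain ⟨A, hA⟩ := Infinite.exists_subset_card_eq ι (δ + 2)
  obtain ⟨t, ht0, ht1, hts⟩ : ∃ t : ℝ, 0 < t ∧ t ≤ 1 ∧ t < s :=
    ⟨min 1 (s / 2), by positivity, min_le_left _ _,
      lt_of_le_of_lt (min_le_right _ _) (by linarith)⟩
  have ht : t ∈ Set.Icc (0 : ℝ) 1 := ⟨ht0.le, ht1⟩
  let g : ι → Hedgehog ι × ℝ := fun i => (Hedgehog.mk i t ht, t)
  have key : ∀ i j : ι, dist (Hedgehog.mk i t ht) (Hedgehog.mk j t ht) ≤ t → i = j := by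
    intro i j hd
    by_contra hne
    rw [Hedgehog.dist_diff i j hne] at hd
    linarith
  have hg : Function.Injective g := by
    intro i j hij
    apply key
    have : Hedgehog.mk i t ht = Hedgehog.mk j t ht := congrArg Prod.fst hij
    rw [this, dist_self]; exact ht0.le
  obtain ⟨G, hGF, hc, hm⟩ := H (A.image g) (by
    intro p hp
    obtain ⟨i, _, rfl⟩ := Finset.mem_image.1 hp
    exact ⟨trivial, ht0.le, hts⟩)
  have hG : A.image g ⊆ G := by
    intro p hp
    obtain ⟨q, hq, hpq⟩ := hc p hp
    obtain ⟨i, _, rfl⟩ := Finset.mem_image.1 hp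
    obtain ⟨j, _, rfl⟩ := Finset.mem_image.1 (hGF hq)
    rw [key i j hpq]; exact hq
  have h1 := hm (Hedgehog.center ι)
  have h2 : A.image g ⊆ G.filter fun q => dist (Hedgehog.center ι) q.1 ≤ q.2 := by
    intro p hp
    refine Finset.mem_filter.2 ⟨hG hp, ?_⟩
    obtain ⟨i, _, rfl⟩ := Finset.mem_image.1 hp
    rw [dist_comm]
    exact (Hedgehog.dist_center i t ht).le
  have h3 := Finset.card_le_card h2
  rw [Finset.card_image_of_injective _ hg, hA] at h3
  omega

theorem Hedgehog.partC [Nonempty ι] (r : ℝ) :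
    NagataDimLE {x : Hedgehog ι | r ≤ dist x (Hedgehog.center ι)} 1 r := by
  classical
  intro F hF
  let P : Finset (Hedgehog ι × ℝ) → Prop := fun G =>
    G ⊆ F ∧ ∀ p ∈ F, ∃ q ∈ G, p.1 ∈ Metric.closedBall q.1 q.2
  have hex : ∃ n, ∃ G, P G ∧ G.card = n :=
    ⟨_, F, ⟨subset_rfl, fun p hp => ⟨p, hp, Metric.mem_closedBall_self (hF p hp).2.1⟩⟩, rfl⟩
  obtain ⟨G, ⟨hGF, hGc⟩, hcard⟩ := Nat.find_spec hex
  refine ⟨G, hGF, hGc, fun z => ?_⟩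
  by_contra hlt
  push Not at hlt
  set S := G.filter fun q => dist z q.1 ≤ q.2 with hS
  have hSne : S.Nonempty := Finset.card_pos.1 (by omega)
  obtain ⟨i, t, ht, rfl⟩ := Hedgehog.exists_mk z
  have hSp : ∀ q ∈ S, q ∈ G ∧ q.2 < r ∧
      ∃ u h, q.1 = Hedgehog.mk i u h ∧ q.1.1 i = u ∧ |t - u| ≤ q.2 ∧ r ≤ u := by
    intro q hq
    obtain ⟨hqG, hqd⟩ := Finset.mem_filter.1 hq
    obtain ⟨hq1, hq2, hq3⟩ := hF q (hGF hqG)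
    obtain ⟨j, u, hu, hqe⟩ := Hedgehog.exists_mk q.1
    rw [Set.mem_setOf_eq, hqe, Hedgehog.dist_center] at hq1
    rw [hqe] at hqd
    obtain rfl := Hedgehog.spine_eq i j t u ht hu (by linarith)
    refine ⟨hqG, hq3, u, hu, hqe, ?_, ?_, hq1⟩
    · rw [hqe]; simp [Hedgehog.mk]
    · rwa [Hedgehog.dist_same] at hqd
  obtain ⟨a, haS, ha⟩ := S.exists_min_image (fun q => q.1.1 i - q.2) hSne
  obtain ⟨b, hbS, hb⟩ := S.exists_max_image (fun q => q.1.1 i + q.2) hSne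
  obtain ⟨c, hcS, hcab⟩ : ∃ c ∈ S, c ∉ ({a, b} : Finset _) := by
    apply Finset.exists_mem_notMem_of_card_lt_card
    exact lt_of_le_of_lt Finset.card_le_two hlt
  simp only [Finset.mem_insert, Finset.mem_singleton, not_or] at hcab
  obtain ⟨haG, har, ua, hua, hae, hai, had, hra⟩ := hSp a haS
  obtain ⟨hbG, hbr, ub, hub, hbe, hbi, hbd, hrb⟩ := hSp b hbS
  obtain ⟨hcG, hcr, uc, huc, hce, hci, hcd, hrc⟩ := hSp c hcS
  have hac := ha c hcS
  have hbc := hb c hcS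
  simp only [hai, hbi, hci] at hac hbc
  have hP : P (G.erase c) := by
    refine ⟨(Finset.erase_subset _ _).trans hGF, fun p hp => ?_⟩
    obtain ⟨q, hq, hpq⟩ := hGc p hp
    by_cases hqc : q = c
    · subst hqc
      obtain ⟨j, v, hv, hpe⟩ := Hedgehog.exists_mk p.1
      rw [Metric.mem_closedBall, hpe, hce] at hpq
      obtain rfl := Hedgehog.spine_eq j i v uc hv huc (by linarith)
      rw [Hedgehog.dist_same] at hpq
      rw [abs_le] at hpq had hbd
      rcases le_total v t with hvt | hvt
      · refine ⟨a, Finset.mem_erase.2 ⟨fun h => hcab.1 h.symm, haG⟩, ?_⟩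
        rw [Metric.mem_closedBall, hpe, hae, Hedgehog.dist_same, abs_le]
        constructor <;> linarith
      · refine ⟨b, Finset.mem_erase.2 ⟨fun h => hcab.2 h.symm, hbG⟩, ?_⟩
        rw [Metric.mem_closedBall, hpe, hbe, Hedgehog.dist_same, abs_le]
        constructor <;> linarith
    · exact ⟨q, Finset.mem_erase.2 ⟨hqc, hq⟩, hpq⟩
  have hmin := Nat.find_min' hex ⟨G.erase c, hP, rfl⟩
  have := Finset.card_erase_lt_of_mem hcG
  omega

end aux

/-- **Example.** For an infinite `ι`: (a) the Nagata dimension of the hedgehog `J(ι)` in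
itself is infinite on every scale `s > 0`; (b) nevertheless `J(ι)` is sigma-finite
dimensional in the sense of Nagata, being the union of the singleton `{0}` and the sets
`Xₙ` of points at distance `≥ 1/n` from the centre, each of which has Nagata dimension
(at most) `1` in `J(ι)` on the scale `1/n`. -/
theorem hedgehog_nagata
    (ι : Type u) [Infinite ι] :
    (∀ s : ℝ, 0 < s → ∀ δ : ℕ, ¬ NagataDimLE (Set.univ : Set (Hedgehog ι)) δ s) ∧
    ((Set.univ : Set (Hedgehog ι)) =
      {Hedgehog.center ι} ∪
        ⋃ n : ℕ, {x : Hedgehog ι | 1 / (n + 1 : ℝ) ≤ dist x (Hedgehog.center ι)}) ∧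
    (∀ n : ℕ,
      NagataDimLE {x : Hedgehog ι | 1 / (n + 1 : ℝ) ≤ dist x (Hedgehog.center ι)} 1
        (1 / (n + 1 : ℝ))) := by
  refine ⟨fun s hs δ => Hedgehog.partA s hs δ, ?_, fun n => Hedgehog.partC _⟩
  ext x
  simp only [Set.mem_univ, Set.mem_union, Set.mem_singleton_iff, Set.mem_iUnion,
    Set.mem_setOf_eq, true_iff]
  by_cases hx : x = Hedgehog.center ι
  · exact Or.inl hx
  · obtain ⟨n, hn⟩ := exists_nat_one_div_lt (dist_pos.2 hx)
    exact Or.inr ⟨n, hn.le⟩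

end
end

section
/- Fix m ≥ 1 and let Δ_{m+1} = {x ∈ ℝ^{m+1} : 0 < x₁ < x₂ < ⋯ < x_{m+1} < 1} and Δ_m = {z ∈ ℝ^m : 0 < z₁ < ⋯ < z_m < 1}. Let κ: Δ_{m+1} → Δ_m be a Lebesgue measurable map such that for every x ∈ Δ_{m+1} the coordinates of κ(x) form an m-element subset of {x₁, …, x_{m+1}} (i.e. κ(x) is obtained from x by deleting one coordinate). Then the set of points z ∈ Δ_m whose preimage κ⁻¹({z}) is infinite has positive m-dimensional Lebesgue measure; in particular, no such κ can be finite-to-one. -/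
open MeasureTheory Set

noncomputable section

/-- The open simplex `Δ_m = {x ∈ ℝ^m : 0 < x₁ < x₂ < ⋯ < x_m < 1}`, identified with the
family of `m`-element subsets of `(0,1)`. -/
def openSimplex (m : ℕ) : Set (Fin m → ℝ) :=
  { x | (∀ i, 0 < x i ∧ x i < 1) ∧ StrictMono x }

lemma openSimplex_isOpen (m : ℕ) : IsOpen (openSimplex m) := by
  have : openSimplex m = (⋂ i, {x : Fin m → ℝ | 0 < x i ∧ x i < 1}) ∩
      ⋂ i, ⋂ j, ⋂ _ : i < j, {x : Fin m → ℝ | x i < x j} := by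
    ext x
    simp only [openSimplex, StrictMono, mem_inter_iff, mem_iInter, mem_ofPred_eq]
  rw [this]
  refine IsOpen.inter (isOpen_iInter_of_finite fun i => ?_)
    (isOpen_iInter_of_finite fun i => isOpen_iInter_of_finite fun j =>
      isOpen_iInter_of_finite fun _ => ?_)
  · exact (isOpen_lt continuous_const (continuous_apply i)).inter
      (isOpen_lt (continuous_apply i) continuous_const)
  · exact isOpen_lt (continuous_apply i) (continuous_apply j)

lemma openSimplex_nonempty (m : ℕ) : (openSimplex m).Nonempty := by
  refine ⟨fun i => ((i : ℕ) + 1 : ℝ) / (m + 1), fun i => ⟨by positivity, ?_⟩, fun i j h => ?_⟩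
  · rw [div_lt_one (by positivity)]
    have : ((i : ℕ) : ℝ) < m := by exact_mod_cast i.2
    linarith
  · have : ((i : ℕ) : ℝ) < (j : ℕ) := by exact_mod_cast h
    dsimp only
    gcongr

lemma null_of_fibers (m : ℕ) (j : Fin (m + 1)) (C : Set (Fin (m + 1) → ℝ))
    (hC : MeasurableSet C)
    (h : ∀ᵐ z : Fin m → ℝ, {t : ℝ | j.insertNth t z ∈ C}.Finite) :
    volume C = 0 := by
  have mp := (volume_preserving_piFinSuccAbove (fun _ : Fin (m + 1) => ℝ) j).symm
  rw [← mp.measure_preimage hC.nullMeasurableSet, Measure.volume_eq_prod,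
    Measure.prod_apply_symm (mp.measurable hC), lintegral_eq_zero_iff' ?_]
  · filter_upwards [h] with z hz
    exact hz.measure_zero volume
  · exact (measurable_measure_prodMk_right (mp.measurable hC)).aemeasurable

theorem compression_map_not_finite_to_one
    (m : ℕ) (hm : 1 ≤ m) (κ : (Fin (m + 1) → ℝ) → (Fin m → ℝ))
    (hκmeas : NullMeasurable κ (volume : Measure (Fin (m + 1) → ℝ)))
    (hκ : ∀ x ∈ openSimplex (m + 1),
      κ x ∈ openSimplex m ∧ ∃ j : Fin (m + 1), κ x = x ∘ j.succAbove) :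
    0 < volume {z : Fin m → ℝ |
        z ∈ openSimplex m ∧ (κ ⁻¹' {z} ∩ openSimplex (m + 1)).Infinite} ∧
    ¬ ∀ z : Fin m → ℝ, (κ ⁻¹' {z} ∩ openSimplex (m + 1)).Finite := by
  have key : 0 < volume {z : Fin m → ℝ |
        z ∈ openSimplex m ∧ (κ ⁻¹' {z} ∩ openSimplex (m + 1)).Infinite} := by
    rw [pos_iff_ne_zero]
    intro h0
    have hae : ∀ᵐ z : Fin m → ℝ, (κ ⁻¹' {z} ∩ openSimplex (m + 1)).Finite := by
      filter_upwards [measure_eq_zero_iff_ae_notMem.1 h0] with z hz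
      by_contra hinf
      obtain ⟨x, hx, hxs⟩ := Set.Infinite.nonempty hinf
      refine hz ⟨?_, hinf⟩
      have hx' : κ x = z := hx
      exact hx' ▸ (hκ x hxs).1
    have hopen := openSimplex_isOpen (m + 1)
    have hκ' : AEMeasurable κ volume := hκmeas.aemeasurable
    have hA : ∀ j : Fin (m + 1),
        volume ({x | κ x = x ∘ j.succAbove} ∩ openSimplex (m + 1)) = 0 := by
      intro j
      have hg : Measurable (fun x : Fin (m + 1) → ℝ => x ∘ j.succAbove) :=
        measurable_pi_lambda _ fun i => measurable_pi_apply _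
      have hnull : NullMeasurableSet
          ({x | κ x = x ∘ j.succAbove} ∩ openSimplex (m + 1)) volume :=
        (nullMeasurableSet_eq_fun hκ' hg.aemeasurable).inter
          hopen.measurableSet.nullMeasurableSet
      obtain ⟨C, hCs, hC, hCe⟩ := hnull.exists_measurable_subset_ae_eq
      rw [← measure_congr hCe]
      apply null_of_fibers m j C hC
      filter_upwards [hae] with z hz
      have hinj : Function.Injective (fun t : ℝ => (j.insertNth t z : Fin (m + 1) → ℝ)) := by
        intro s t hst
        simpa using congrFun hst j
      refine (hz.preimage hinj.injOn).subset ?_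
      intro t ht
      obtain ⟨h1, h2⟩ := hCs ht
      refine ⟨?_, h2⟩
      have h1' : κ (j.insertNth t z) = (j.insertNth t z : Fin (m + 1) → ℝ) ∘ j.succAbove := h1
      show κ (j.insertNth t z) = z
      rw [h1']
      ext i
      simp
    have hpos := hopen.measure_pos volume (openSimplex_nonempty (m + 1))
    refine hpos.ne' (measure_mono_null ?_ (measure_iUnion_null hA))
    intro x hx
    obtain ⟨j, hj⟩ := (hκ x hx).2
    exact mem_iUnion.2 ⟨j, hj, hx⟩
  refine ⟨key, fun hfin => ?_⟩
  have : {z : Fin m → ℝ |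
        z ∈ openSimplex m ∧ (κ ⁻¹' {z} ∩ openSimplex (m + 1)).Infinite} = ∅ :=
    eq_empty_of_forall_notMem fun z hz => hz.2 (hfin z)
  rw [this] at key
  simp at key

end
end
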